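/- arXiv:2011.05953 — 2 statements merged into one kernel-verified Lean document; each statement's English description precedes it below -/
import Mathlib

section
/- Let f ∈ F₁(a,b) with f*(y) < ∞ for all y ∈ ℝ, let S be a metric space, and let Q, P be Borel probability measures on S. Then D_f(Q‖P) = sup over bounded continuous g : S → ℝ of {E_Q[g] − E_P[f*(g)]}. Consequently, the map (Q,P) ↦ D_f(Q‖P) is jointly lower semicontinuous with respect to weak convergence of probability measures. -/
open MeasureTheory Filter Set Topology ENNReal
open scoped Classical

noncomputable section

/-- The set of bounded measurable real-valued functions on `Ω`. -/
def Mb (Ω : Type*) [MeasurableSpace Ω] : Set (Ω → ℝ) :=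
  {g | Measurable g ∧ ∃ C : ℝ, ∀ x, |g x| ≤ C}

/-- The set of bounded continuous real-valued functions on `S`. -/
def Cb (S : Type*) [TopologicalSpace S] : Set (S → ℝ) :=
  {g | Continuous g ∧ ∃ C : ℝ, ∀ x, |g x| ≤ C}

/-- The positive part of an extended real number, as an element of `ℝ≥0∞`. -/
def posE (x : EReal) : ℝ≥0∞ := if x = ⊤ then ⊤ else ENNReal.ofReal x.toReal

/-- The extended-real-valued integral of an `EReal`-valued function, defined as the
difference of the lower integrals of the positive and negative parts, with the
convention `∞ - ∞ = -∞`. -/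
def eIntegral {Ω : Type*} [MeasurableSpace Ω] (P : Measure Ω) (h : Ω → EReal) : EReal :=
  ((∫⁻ x, posE (h x) ∂P : ℝ≥0∞) : EReal) - ((∫⁻ x, posE (-(h x)) ∂P : ℝ≥0∞) : EReal)

/-- The Legendre transform `f*(y) = sup_x {x*y - f(x)}` of `f : ℝ → (-∞,∞]`. -/
def fstar (f : ℝ → EReal) (y : ℝ) : EReal := ⨆ x : ℝ, (((x * y : ℝ) : EReal) - f x)

/-- `f : ℝ → (-∞,∞]` is (the convex LSC extension of) an element of `F₁(a,b)`:
convex, lower semicontinuous, never `-∞`, finite exactly on the interval `(a,b)`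
(with `+∞` strictly outside `[a,b]`), and `f(1) = 0` with `a < 1 < b`. -/
structure IsF1 (a b : EReal) (f : ℝ → EReal) : Prop where
  a_lt_one : a < ((1 : ℝ) : EReal)
  one_lt_b : ((1 : ℝ) : EReal) < b
  convex : ∀ x y t : ℝ, 0 < t → t < 1 →
    f (t * x + (1 - t) * y) ≤ ((t : ℝ) : EReal) * f x + (((1 - t : ℝ)) : EReal) * f y
  lsc : LowerSemicontinuous f
  ne_bot : ∀ x, f x ≠ ⊥
  finite_on : ∀ x : ℝ, a < (x : EReal) → (x : EReal) < b → f x ≠ ⊤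
  top_outside : ∀ x : ℝ, ((x : EReal) < a ∨ b < (x : EReal)) → f x = ⊤
  at_one : f 1 = 0

/-- `Λ_f^P[g] = inf_{ν ∈ ℝ} {ν + E_P[f*(g - ν)]}`. -/
def LambdaF {Ω : Type*} [MeasurableSpace Ω] (f : ℝ → EReal) (P : Measure Ω) (g : Ω → ℝ) :
    EReal :=
  ⨅ ν : ℝ, ((ν : EReal) + eIntegral P (fun x => fstar f (g x - ν)))

/-- The classical `f`-divergence `D_f(Q‖P) = E_P[f(dQ/dP)]` if `Q ≪ P`, else `∞`. -/
def fDivE {Ω : Type*} [MeasurableSpace Ω] (f : ℝ → EReal) (Q P : Measure Ω) : EReal :=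
  if Q ≪ P then eIntegral P (fun x => f ((Q.rnDeriv P x).toReal)) else ⊤

/-- The `(f,Γ)`-divergence `D_f^Γ(Q‖P) = sup_{g ∈ Γ} {E_Q[g] - Λ_f^P[g]}`. -/
def fGammaDiv {Ω : Type*} [MeasurableSpace Ω] (f : ℝ → EReal) (Γ : Set (Ω → ℝ))
    (Q P : Measure Ω) : EReal :=
  ⨆ g ∈ Γ, (((∫ x, g x ∂Q : ℝ) : EReal) - LambdaF f P g)

/-- The `Γ`-IPM `W^Γ(Q,P) = sup_{g ∈ Γ} {E_Q[g] - E_P[g]}`. -/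
def ipmW {Ω : Type*} [MeasurableSpace Ω] (Γ : Set (Ω → ℝ)) (Q P : Measure Ω) : EReal :=
  ⨆ g ∈ Γ, (((∫ x, g x ∂Q : ℝ) : EReal) - ((∫ x, g x ∂P : ℝ) : EReal))

end

section Convexity

lemma fs_facts {a b : EReal} {f : ℝ → EReal} (hf : IsF1 a b f)
    (hfin : ∀ y : ℝ, fstar f y ≠ ⊤) :
    ∀ y, fstar f y = (((fstar f y).toReal : ℝ) : EReal) := by
  intro y
  rw [EReal.coe_toReal (hfin y)]
  intro h
  have h1 : (((1 * y : ℝ) : EReal) - f 1) ≤ fstar f y := le_iSup (fun x : ℝ => (((x * y : ℝ) : EReal) - f x)) 1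
  rw [h, hf.at_one, le_bot_iff, sub_zero] at h1
  exact EReal.coe_ne_bot _ h1

lemma fs_young {a b : EReal} {f : ℝ → EReal} (hf : IsF1 a b f) {fs : ℝ → ℝ}
    (hfs : ∀ y, fstar f y = (fs y : EReal)) (x y : ℝ) :
    ((x * y - fs y : ℝ) : EReal) ≤ f x := by
  have h1 : (((x * y : ℝ) : EReal) - f x) ≤ fstar f y := le_iSup (fun x : ℝ => (((x * y : ℝ) : EReal) - f x)) x
  rw [hfs y] at h1
  have hb := hf.ne_bot x
  induction h : f x with
  | bot => exact absurd h hb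
  | top => exact le_top
  | coe v =>
    rw [h] at h1
    norm_cast at h1 ⊢
    linarith

lemma fs_le {a b : EReal} {f : ℝ → EReal} (hf : IsF1 a b f) {fs : ℝ → ℝ}
    (hfs : ∀ y, fstar f y = (fs y : EReal)) (y c : ℝ)
    (h : ∀ x v : ℝ, f x = v → x * y - v ≤ c) : fs y ≤ c := by
  rw [← EReal.coe_le_coe_iff, ← hfs y]
  refine iSup_le fun x => ?_
  have hb := hf.ne_bot x
  induction hx : f x with
  | bot => exact absurd hx hb
  | top => simp
  | coe v =>
    have := h x v hx
    exact_mod_cast this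

lemma fs_convex {a b : EReal} {f : ℝ → EReal} (hf : IsF1 a b f) {fs : ℝ → ℝ}
    (hfs : ∀ y, fstar f y = (fs y : EReal)) : ConvexOn ℝ univ fs := by
  refine ⟨convex_univ, ?_⟩
  intro y₁ _ y₂ _ s t hs ht hst
  refine fs_le hf hfs _ _ fun x v hx => ?_
  have h1 := fs_young hf hfs x y₁
  have h2 := fs_young hf hfs x y₂
  rw [hx] at h1 h2
  norm_cast at h1 h2
  simp only [smul_eq_mul]
  have h3 : v = s * v + t * v := by rw [← add_mul, hst, one_mul]
  nlinarith [mul_le_mul_of_nonneg_left h1 hs, mul_le_mul_of_nonneg_left h2 ht]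

lemma fs_biconj {a b : EReal} {f : ℝ → EReal} (hf : IsF1 a b f) {fs : ℝ → ℝ}
    (hfs : ∀ y, fstar f y = (fs y : EReal)) (x₀ t₀ : ℝ) (h : (t₀ : EReal) < f x₀) :
    ∃ y, t₀ < x₀ * y - fs y := by
  set E : Set (ℝ × ℝ) := {p | f p.1 ≤ (p.2 : EReal)} with hE
  have hcl : IsClosed E := by
    have h1 := hf.lsc.isClosed_epigraph
    exact h1.preimage (f := fun p : ℝ × ℝ => (p.1, (p.2 : EReal)))
      (continuous_fst.prodMk (continuous_coe_real_ereal.comp continuous_snd))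
  have hcv : Convex ℝ E := by
    rw [convex_iff_forall_pos]
    intro p hp q hq s t hs ht hst
    have hp' : f p.1 ≤ (p.2 : EReal) := hp
    have hq' : f q.1 ≤ (q.2 : EReal) := hq
    obtain rfl : t = 1 - s := by linarith
    have h1 := hf.convex p.1 q.1 s hs (by linarith)
    show f (s * p.1 + (1 - s) * q.1) ≤ ((s * p.2 + (1 - s) * q.2 : ℝ) : EReal)
    refine h1.trans ?_
    push_cast
    refine add_le_add (mul_le_mul_of_nonneg_left hp' (by exact_mod_cast hs.le)) ?_
    have := mul_le_mul_of_nonneg_left hq' (a := ((1 - s : ℝ) : EReal)) (by exact_mod_cast ht.le)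
    simpa using this
  have hnot : (x₀, t₀) ∉ E := fun hh => absurd h (not_lt.2 hh)
  obtain ⟨φ, u, hu1, hu2⟩ := geometric_hahn_banach_point_closed hcv hcl hnot
  set α := φ (1, 0) with hα
  set β := φ (0, 1) with hβ
  have hφ : ∀ x t : ℝ, φ (x, t) = α * x + β * t := by
    intro x t
    have : ((x, t) : ℝ × ℝ) = x • (1, 0) + t • (0, 1) := by simp
    rw [this, map_add, map_smul, map_smul, smul_eq_mul, smul_eq_mul]; ring
  rw [hφ] at hu1
  have hu3 : ∀ x v : ℝ, f x = v → ∀ t, v ≤ t → u < α * x + β * t := by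
    intro x v hx t ht
    rw [← hφ]
    apply hu2
    show f x ≤ (t : EReal)
    rw [hx]; exact_mod_cast ht
  have hβ0 : 0 ≤ β := by
    by_contra hneg
    push Not at hneg
    have h1 := hu3 1 0 (by simpa using hf.at_one) (max 0 ((u - α) / β)) (le_max_left _ _)
    have h2 : β * max 0 ((u - α) / β) ≤ β * ((u - α) / β) :=
      mul_le_mul_of_nonpos_left (le_max_right _ _) hneg.le
    rw [mul_div_cancel₀ _ hneg.ne] at h2
    linarith
  rcases hβ0.eq_or_lt with h0 | hpos
  · rw [← h0] at hu1 hu3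
    obtain ⟨n, hn⟩ := exists_nat_gt ((t₀ + fs 0) / (u - α * x₀))
    have hd : 0 < u - α * x₀ := by linarith
    rw [div_lt_iff₀ hd] at hn
    refine ⟨-(n * α), ?_⟩
    have : fs (-(n * α)) ≤ fs 0 - n * u := by
      refine fs_le hf hfs _ _ fun x v hx => ?_
      have h1 := hu3 x v hx v le_rfl
      have h2 := fs_young hf hfs x 0
      rw [hx] at h2
      norm_cast at h2
      have : (n : ℝ) * u ≤ n * (α * x + 0 * v) := by gcongr
      nlinarith
    nlinarith
  · refine ⟨-(α / β), ?_⟩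
    have : fs (-(α / β)) ≤ - (u / β) := by
      refine fs_le hf hfs _ _ fun x v hx => ?_
      have h1 := hu3 x v hx v le_rfl
      have : u / β ≤ (α * x + β * v) / β := by gcongr
      have e : (α * x + β * v) / β = x * (α / β) + v := by field_simp
      linarith
    have h2 : (α * x₀ + β * t₀) / β < u / β := by gcongr
    have e : (α * x₀ + β * t₀) / β = x₀ * (α / β) + t₀ := by field_simp
    linarith

end Convexity

section Integral

lemma posE_mono {x y : EReal} (h : x ≤ y) : posE x ≤ posE y := by
  unfold posE
  by_cases hy : y = ⊤
  · simp [hy]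
  · have hx : x ≠ ⊤ := fun h' => hy (top_le_iff.1 (h' ▸ h))
    rw [if_neg hx, if_neg hy]
    by_cases hb : x = ⊥
    · simp [hb]
    · exact ENNReal.ofReal_le_ofReal (EReal.toReal_le_toReal h hb hy)

lemma posE_coe (r : ℝ) : posE (r : EReal) = ENNReal.ofReal r := by
  simp [posE]

variable {Ω : Type*} [MeasurableSpace Ω]

lemma eIntegral_mono {P : Measure Ω} {h k : Ω → EReal} (hk : ∀ᵐ x ∂P, h x ≤ k x) :
    eIntegral P h ≤ eIntegral P k := by
  unfold eIntegral
  refine EReal.sub_le_sub ?_ ?_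
  · exact EReal.coe_ennreal_le_coe_ennreal_iff.2
      (lintegral_mono_ae (hk.mono fun x hx => posE_mono hx))
  · exact EReal.coe_ennreal_le_coe_ennreal_iff.2
      (lintegral_mono_ae (hk.mono fun x hx => posE_mono (EReal.neg_le_neg_iff.2 hx)))

lemma eIntegral_coe {P : Measure Ω} {h : Ω → ℝ} (hi : Integrable h P) :
    eIntegral P (fun x => (h x : EReal)) = ((∫ x, h x ∂P : ℝ) : EReal) := by
  unfold eIntegral
  rw [integral_eq_lintegral_pos_part_sub_lintegral_neg_part hi]
  simp only [← EReal.coe_neg, posE_coe]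
  have h1 : ∫⁻ x, ENNReal.ofReal (h x) ∂P ≠ ⊤ := hi.lintegral_lt_top.ne
  have h2 : ∫⁻ x, ENNReal.ofReal (-h x) ∂P ≠ ⊤ := hi.neg.lintegral_lt_top.ne
  lift (∫⁻ x, ENNReal.ofReal (h x) ∂P) to NNReal using h1 with p
  lift (∫⁻ x, ENNReal.ofReal (-h x) ∂P) to NNReal using h2 with q
  simp
  rfl

end Integral

section Main

lemma integrable_of_abs_le {Ω : Type*} [MeasurableSpace Ω] {P : Measure Ω} [IsFiniteMeasure P]
    {g : Ω → ℝ} (hg : Measurable g) {C : ℝ} (hC : ∀ x, |g x| ≤ C) : Integrable g P :=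
  Integrable.of_bound hg.aestronglyMeasurable C (Eventually.of_forall hC)

lemma comp_bound {Ω : Type*} {fs : ℝ → ℝ} (hc : Continuous fs) {g : Ω → ℝ} {C : ℝ}
    (hC : ∀ x, |g x| ≤ C) : ∃ D : ℝ, ∀ x, |fs (g x)| ≤ D := by
  obtain ⟨D, hD⟩ := (isCompact_Icc (a := -C) (b := C)).exists_bound_of_continuousOn hc.continuousOn
  exact ⟨D, fun x => hD _ (abs_le.1 (hC x))⟩

lemma integrable_comp {Ω : Type*} [MeasurableSpace Ω] {P : Measure Ω} [IsFiniteMeasure P]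
    {fs : ℝ → ℝ} (hc : Continuous fs) {g : Ω → ℝ} (hg : g ∈ Mb Ω) :
    Integrable (fun x => fs (g x)) P := by
  obtain ⟨hm, C, hC⟩ := hg
  obtain ⟨D, hD⟩ := comp_bound hc hC
  exact integrable_of_abs_le (hc.measurable.comp hm) hD

lemma exists_cont_approx {S : Type*} [MetricSpace S] [MeasurableSpace S] [BorelSpace S]
    {fs : ℝ → ℝ} (hcv : ConvexOn ℝ univ fs) (hc : Continuous fs)
    (Q P : Measure S) [IsProbabilityMeasure Q] [IsProbabilityMeasure P]
    {g : S → ℝ} (hg : g ∈ Mb S) {ε : ℝ} (hε : 0 < ε) :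
    ∃ k ∈ Cb S, ∫ x, g x ∂Q - ∫ x, fs (g x) ∂P - ε ≤ ∫ x, k x ∂Q - ∫ x, fs (k x) ∂P := by
  have hgI := hg
  obtain ⟨hm, C, hC⟩ := hg
  obtain ⟨K, hK⟩ : ∃ K, LipschitzOnWith K fs (Metric.ball 0 (C + 1)) := by
    refine ConvexOn.exists_lipschitzOnWith_of_isBounded (r := C + 2)
      (hcv.subset (subset_univ _) (convex_ball _ _)) (by linarith) ?_
    exact (((isCompact_closedBall (0 : ℝ) (C + 2)).image hc).isBounded).subset
      (image_mono Metric.ball_subset_closedBall)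
  have hI : ∀ (μ : Measure S) [IsFiniteMeasure μ], Integrable g μ := fun μ _ =>
    integrable_of_abs_le hm hC
  have hδ : 0 < ε / (1 + K) := by positivity
  obtain ⟨k0, hk0, hk0I⟩ := (hI (Q + P)).exists_boundedContinuous_integral_sub_le hδ
  set k : S → ℝ := fun x => max (-C) (min C (k0 x)) with hk
  have hkc : Continuous k := by fun_prop
  have hC0 : ∀ x : S, 0 ≤ C := fun x => (abs_nonneg _).trans (hC x)
  have hkC : ∀ x, |k x| ≤ C := fun x => by
    rw [abs_le]
    exact ⟨le_max_left _ _, max_le (by linarith [hC0 x]) (min_le_left _ _)⟩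
  have hkM : k ∈ Mb S := ⟨hkc.measurable, C, hkC⟩
  have hclose : ∀ x, |g x - k x| ≤ |g x - k0 x| := by
    intro x
    have h1 : g x = max (-C) (min C (g x)) := by
      have := abs_le.1 (hC x)
      rw [min_eq_right this.2, max_eq_right this.1]
    conv_lhs => rw [h1]
    refine (abs_max_sub_max_le_max _ _ _ _).trans ?_
    rw [sub_self, abs_zero]
    refine max_le (abs_nonneg _) ?_
    refine (abs_min_sub_min_le_max _ _ _ _).trans ?_
    simp
  have hkI : ∀ (μ : Measure S) [IsFiniteMeasure μ], Integrable k μ := fun μ _ =>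
    integrable_of_abs_le hkc.measurable hkC
  have hadd : ∫ x, |g x - k x| ∂Q + ∫ x, |g x - k x| ∂P ≤ ε / (1 + K) := by
    rw [← integral_add_measure (f := fun x => |g x - k x|) ((hI Q).sub (hkI Q)).abs
      ((hI P).sub (hkI P)).abs]
    refine le_trans ?_ hk0
    exact integral_mono ((hI _).sub (hkI _)).abs ((hI _).sub hk0I).norm hclose
  have hQ : ∫ x, g x ∂Q - ∫ x, k x ∂Q ≤ ∫ x, |g x - k x| ∂Q := by
    rw [← integral_sub (hI Q) (hkI Q)]
    exact integral_mono ((hI _).sub (hkI _)) ((hI _).sub (hkI _)).abs fun x => le_abs_self _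
  have hP : ∫ x, fs (k x) ∂P - ∫ x, fs (g x) ∂P ≤ K * ∫ x, |g x - k x| ∂P := by
    rw [← integral_sub (integrable_comp hc hkM) (integrable_comp hc hgI), ← integral_const_mul]
    refine integral_mono ((integrable_comp hc hkM).sub (integrable_comp hc hgI))
      (((hI _).sub (hkI _)).abs.const_mul _) fun x => ?_
    have hb : ∀ z, |z| ≤ C → z ∈ Metric.ball (0 : ℝ) (C + 1) := fun z hz => by
      rw [mem_ball_zero_iff, Real.norm_eq_abs]; linarith
    have := hK.dist_le_mul _ (hb _ (hkC x)) _ (hb _ (hC x))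
    rw [Real.dist_eq, Real.dist_eq, abs_sub_comm (k x)] at this
    exact (le_abs_self _).trans this
  refine ⟨k, ⟨hkc, C, hkC⟩, ?_⟩
  have n1 : 0 ≤ ∫ x, |g x - k x| ∂Q := integral_nonneg fun x => abs_nonneg _
  have n2 : 0 ≤ ∫ x, |g x - k x| ∂P := integral_nonneg fun x => abs_nonneg _
  have hK0 : (0 : ℝ) ≤ K := K.2
  rw [le_div_iff₀ (by positivity)] at hadd
  nlinarith

lemma rnDeriv_facts {Ω : Type*} [MeasurableSpace Ω] (Q P : Measure Ω)
    [IsProbabilityMeasure Q] [IsProbabilityMeasure P] (hQP : Q ≪ P)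
    {fs : ℝ → ℝ} (hc : Continuous fs) {g : Ω → ℝ} (hg : g ∈ Mb Ω) :
    Integrable (fun x => (Q.rnDeriv P x).toReal * g x - fs (g x)) P ∧
    ∫ x, ((Q.rnDeriv P x).toReal * g x - fs (g x)) ∂P = ∫ x, g x ∂Q - ∫ x, fs (g x) ∂P := by
  have h1 : Integrable (fun x => (Q.rnDeriv P x).toReal * g x) P := by
    obtain ⟨hm, C, hC⟩ := hg
    exact Measure.integrable_toReal_rnDeriv.mul_bdd (c := C) hm.aestronglyMeasurable
      (Eventually.of_forall hC)
  refine ⟨h1.sub (integrable_comp hc hg), ?_⟩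
  rw [integral_sub h1 (integrable_comp hc hg), integral_toReal_rnDeriv_mul hQP]

/-- Greedy approximate maximizers. -/
noncomputable def greedy {Ω : Type*} (r : Ω → ℝ) (fs : ℝ → ℝ) : ℕ → Ω → ℝ
  | 0 => fun _ => 0
  | n + 1 => fun x =>
      if r x * greedy r fs n x - fs (greedy r fs n x)
          < r x * TopologicalSpace.denseSeq ℝ n - fs (TopologicalSpace.denseSeq ℝ n)
      then TopologicalSpace.denseSeq ℝ n else greedy r fs n x

lemma greedy_mem {Ω : Type*} [MeasurableSpace Ω] {r : Ω → ℝ} (hr : Measurable r) {fs : ℝ → ℝ}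
    (hc : Continuous fs) (n : ℕ) : greedy r fs n ∈ Mb Ω := by
  induction n with
  | zero => exact ⟨measurable_const, 0, fun x => by simp [greedy]⟩
  | succ n ih =>
    obtain ⟨hm, C, hC⟩ := ih
    refine ⟨?_, max C |TopologicalSpace.denseSeq ℝ n|, fun x => ?_⟩
    · refine Measurable.ite (measurableSet_lt ?_ ?_) measurable_const hm
      · exact (hr.mul hm).sub (hc.measurable.comp hm)
      · exact (hr.mul_const _).sub_const _
    · simp only [greedy]
      split_ifs
      · exact le_max_right _ _
      · exact (hC x).trans (le_max_left _ _)

lemma greedy_step {Ω : Type*} (r : Ω → ℝ) (fs : ℝ → ℝ) (n : ℕ) (x : Ω) :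
    r x * greedy r fs n x - fs (greedy r fs n x)
      ≤ r x * greedy r fs (n + 1) x - fs (greedy r fs (n + 1) x) ∧
    r x * TopologicalSpace.denseSeq ℝ n - fs (TopologicalSpace.denseSeq ℝ n)
      ≤ r x * greedy r fs (n + 1) x - fs (greedy r fs (n + 1) x) := by
  simp only [greedy]
  split_ifs with h
  · exact ⟨h.le, le_rfl⟩
  · exact ⟨le_rfl, not_lt.1 h⟩

lemma upper_bound {Ω : Type*} [MeasurableSpace Ω] {a b : EReal} {f : ℝ → EReal} (hf : IsF1 a b f)
    {fs : ℝ → ℝ} (hfs : ∀ y, fstar f y = (fs y : EReal)) (hc : Continuous fs)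
    (Q P : Measure Ω) [IsProbabilityMeasure Q] [IsProbabilityMeasure P] (hQP : Q ≪ P) (m : ℝ)
    (hm : ∀ g ∈ Mb Ω, ∫ x, g x ∂Q - ∫ x, fs (g x) ∂P ≤ m) :
    eIntegral P (fun x => f ((Q.rnDeriv P x).toReal)) ≤ (m : EReal) := by
  set r : Ω → ℝ := fun x => (Q.rnDeriv P x).toReal with hr
  have hrm : Measurable r := (Measure.measurable_rnDeriv Q P).ennreal_toReal
  set F : ℕ → Ω → ℝ := fun n x => r x * greedy r fs n x - fs (greedy r fs n x) with hF
  set c := fs 0 with hc0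
  have hFmono : ∀ x, Monotone fun n => F n x := fun x =>
    monotone_nat_of_le_succ fun n => (greedy_step r fs n x).1
  have hF0 : ∀ n x, 0 ≤ F n x + c := fun n x => by
    have h0 := hFmono x (Nat.zero_le n)
    have h1 : F 0 x = - c := by simp [hF, greedy, hc0]
    simp only [h1] at h0
    linarith
  have hFm : ∀ n, Measurable (F n) := fun n => by
    have := (greedy_mem hrm hc n).1
    exact (hrm.mul this).sub (hc.measurable.comp this)
  have hFI : ∀ n, Integrable (F n) P ∧ ∫ x, F n x ∂P ≤ m := fun n => by
    obtain ⟨h1, h2⟩ := rnDeriv_facts Q P hQP hc (greedy_mem hrm hc n)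
    exact ⟨h1, h2.trans_le (hm _ (greedy_mem hrm hc n))⟩
  set H : Ω → ℝ≥0∞ := fun x => ⨆ n, ENNReal.ofReal (F n x + c) with hH
  have hHm : Measurable H := Measurable.iSup fun n => ((hFm n).add_const c).ennreal_ofReal
  have hHle : ∫⁻ x, H x ∂P ≤ ENNReal.ofReal (m + c) := by
    rw [lintegral_iSup (fun n => ((hFm n).add_const c).ennreal_ofReal)
      (fun i j hij x => ENNReal.ofReal_le_ofReal (by
        have := hFmono x hij
        simp only at this
        linarith))]
    refine iSup_le fun n => ?_
    rw [← ofReal_integral_eq_lintegral_ofReal (f := fun x => F n x + c) ((hFI n).1.add (integrable_const c))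
      (Eventually.of_forall (hF0 n))]
    refine ENNReal.ofReal_le_ofReal ?_
    rw [integral_add (hFI n).1 (integrable_const c)]
    simpa using (hFI n).2
  have hmc : 0 ≤ m + c := by
    have := hm (fun _ => 0) ⟨measurable_const, 0, by simp⟩
    simp at this
    linarith
  have hHtop : ∫⁻ x, H x ∂P ≠ ⊤ := (hHle.trans_lt ENNReal.ofReal_lt_top).ne
  have hHI : Integrable (fun x => (H x).toReal) P :=
    integrable_toReal_of_lintegral_ne_top hHm.aemeasurable hHtop
  have key : ∀ᵐ x ∂P, f (r x) ≤ (((H x).toReal - c : ℝ) : EReal) := by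
    filter_upwards [ae_lt_top hHm hHtop] with x hx
    by_contra hlt
    push Not at hlt
    obtain ⟨y, hy⟩ := fs_biconj hf hfs _ _ hlt
    have hopen : IsOpen {y : ℝ | (H x).toReal - c < r x * y - fs y} :=
      isOpen_lt continuous_const (by fun_prop)
    obtain ⟨z, hz, n, rfl⟩ := (TopologicalSpace.denseRange_denseSeq ℝ).inter_open_nonempty _ hopen ⟨y, hy⟩
    have h1 := (greedy_step r fs n x).2
    have h2 : ENNReal.ofReal (F (n + 1) x + c) ≤ H x := le_iSup (fun n => ENNReal.ofReal (F n x + c)) (n + 1)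
    rw [ENNReal.ofReal_le_iff_le_toReal hx.ne] at h2
    simp only [mem_ofPred_eq] at hz
    simp only [hF] at h2
    linarith
  refine (eIntegral_mono key).trans ?_
  rw [eIntegral_coe (h := fun x => (H x).toReal - c) (hHI.sub (integrable_const c)), integral_sub hHI (integrable_const c),
    integral_toReal hHm.aemeasurable (ae_lt_top hHm hHtop)]
  have := ENNReal.toReal_mono ENNReal.ofReal_ne_top hHle
  rw [ENNReal.toReal_ofReal hmc] at this
  rw [EReal.coe_le_coe_iff]
  simp
  linarith

lemma div_eq {S : Type*} [MetricSpace S] [MeasurableSpace S] [BorelSpace S]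
    {a b : EReal} {f : ℝ → EReal} (hf : IsF1 a b f)
    {fs : ℝ → ℝ} (hfs : ∀ y, fstar f y = (fs y : EReal)) (hcv : ConvexOn ℝ univ fs)
    (hc : Continuous fs)
    (Q P : Measure S) [IsProbabilityMeasure Q] [IsProbabilityMeasure P] :
    fDivE f Q P = ⨆ g ∈ Cb S, ((∫ x, g x ∂Q - ∫ x, fs (g x) ∂P : ℝ) : EReal) := by
  have hCM : Cb S ⊆ Mb S := fun g hg => ⟨hg.1.measurable, hg.2⟩
  apply le_antisymm
  · refine EReal.le_of_forall_lt_iff_le.1 fun m hm => ?_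
    have hCb : ∀ g ∈ Cb S, ∫ x, g x ∂Q - ∫ x, fs (g x) ∂P ≤ m := fun g hg => by
      rw [← EReal.coe_le_coe_iff]
      exact (le_iSup₂ (f := fun g (_ : g ∈ Cb S) =>
        ((∫ x, g x ∂Q - ∫ x, fs (g x) ∂P : ℝ) : EReal)) g hg).trans hm.le
    have hMb : ∀ g ∈ Mb S, ∫ x, g x ∂Q - ∫ x, fs (g x) ∂P ≤ m := fun g hg => by
      refine le_of_forall_pos_le_add fun ε hε => ?_
      obtain ⟨k, hk, h⟩ := exists_cont_approx hcv hc Q P hg hε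
      linarith [hCb k hk]
    unfold fDivE
    split_ifs with hQP
    · exact upper_bound hf hfs hc Q P hQP m hMb
    · exfalso
      apply hQP
      refine Measure.AbsolutelyContinuous.mk fun A hA hPA => ?_
      by_contra hQA
      have hq : 0 < Q.real A := ENNReal.toReal_pos hQA (measure_ne_top _ _)
      obtain ⟨n, hn⟩ := exists_nat_gt ((m + fs 0) / Q.real A)
      rw [div_lt_iff₀ hq] at hn
      have h := hMb (A.indicator fun _ => (n : ℝ)) ⟨measurable_const.indicator hA, n, fun x => by
        by_cases hx : x ∈ A <;> simp [hx]⟩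
      rw [integral_indicator_const _ hA] at h
      have h2 : ∫ x, fs (A.indicator (fun _ => (n : ℝ)) x) ∂P = ∫ x, fs 0 ∂P := by
        refine integral_congr_ae ?_
        have : ∀ᵐ x ∂P, x ∉ A := measure_eq_zero_iff_ae_notMem.1 hPA
        filter_upwards [this] with x hx
        simp [hx]
      rw [h2] at h
      simp at h
      nlinarith
  · refine iSup₂_le fun g hg => ?_
    unfold fDivE
    split_ifs with hQP
    · obtain ⟨h1, h2⟩ := rnDeriv_facts Q P hQP hc (hCM hg)
      rw [← h2, ← eIntegral_coe h1]
      exact eIntegral_mono (Eventually.of_forall fun x => fs_young hf hfs _ _)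
    · exact le_top

lemma cont_integral {S : Type*} [MetricSpace S] [MeasurableSpace S] [BorelSpace S]
    {g : S → ℝ} (hg : g ∈ Cb S) :
    Continuous fun p : ProbabilityMeasure S => ∫ x, g x ∂(p : Measure S) := by
  obtain ⟨hc, C, hC⟩ := hg
  rw [continuous_iff_continuousAt]
  intro p
  exact ProbabilityMeasure.tendsto_iff_forall_integral_tendsto.1 tendsto_id
    (BoundedContinuousFunction.ofNormedAddCommGroup g hc C hC)

end Main

/-- If `f*` is everywhere finite then on a metric space the classical
`f`-divergence satisfies `D_f(Q‖P) = sup_{g ∈ C_b(S)} {E_Q[g] - E_P[f*(g)]}`; consequently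
`(Q,P) ↦ D_f(Q‖P)` is jointly lower semicontinuous for the topology of weak convergence. -/
theorem stmt1 {S : Type*} [MetricSpace S] [MeasurableSpace S] [BorelSpace S]
    (a b : EReal) (f : ℝ → EReal) (hf : IsF1 a b f)
    (hfin : ∀ y : ℝ, fstar f y ≠ ⊤) :
    (∀ Q P : Measure S, IsProbabilityMeasure Q → IsProbabilityMeasure P →
      fDivE f Q P
        = ⨆ g ∈ Cb S, (((∫ x, g x ∂Q : ℝ) : EReal) - eIntegral P (fun x => fstar f (g x))))
    ∧ LowerSemicontinuous (fun p : ProbabilityMeasure S × ProbabilityMeasure S =>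
        fDivE f (p.1 : Measure S) (p.2 : Measure S)) := by
  have hfs := fs_facts hf hfin
  generalize hF : (fun y => (fstar f y).toReal) = fs at *
  have hfs : ∀ y, fstar f y = (fs y : EReal) := fun y => by rw [← hF]; exact hfs y
  have hcv := fs_convex hf hfs
  have hc : Continuous fs := hcv.locallyLipschitz.continuous
  refine ⟨fun Q P _ _ => ?_, ?_⟩
  · rw [div_eq hf hfs hcv hc Q P]
    refine iSup_congr fun g => iSup_congr fun hg => ?_
    simp only [hfs]
    rw [eIntegral_coe (integrable_comp hc ⟨hg.1.measurable, hg.2⟩), EReal.coe_sub]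
  · have : (fun p : ProbabilityMeasure S × ProbabilityMeasure S =>
        fDivE f (p.1 : Measure S) (p.2 : Measure S)) = fun p => ⨆ g, ⨆ _ : g ∈ Cb S,
          ((∫ x, g x ∂(p.1 : Measure S) - ∫ x, fs (g x) ∂(p.2 : Measure S) : ℝ) : EReal) := by
      funext p
      exact div_eq hf hfs hcv hc _ _
    rw [this]
    refine lowerSemicontinuous_biSup fun g hg => Continuous.lowerSemicontinuous ?_
    have hg' : (fun x => fs (g x)) ∈ Cb S :=
      ⟨hc.comp hg.1, hg.2.elim fun C hC => comp_bound hc hC⟩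
    exact continuous_coe_real_ereal.comp
      (((cont_integral hg).comp continuous_fst).sub ((cont_integral hg').comp continuous_snd))
end

section
/- Let S be a complete separable metric space, let f ∈ F₁(a,b) be admissible, let Γ ⊂ C_b(S) be admissible, and let Q, P be Borel probability measures on S. Then the infimal convolution formula holds: D_f^Γ(Q‖P) = inf over Borel probability measures η on S of {D_f(η‖P) + W^Γ(Q,η)}; in particular 0 ≤ D_f^Γ(Q‖P) ≤ min{D_f(Q‖P), W^Γ(Q,P)}. Moreover, if D_f^Γ(Q‖P) < ∞ then there exists a Borel probability measure η* on S with D_f^Γ(Q‖P) = D_f(η*‖P) + W^Γ(Q,η*), and if f is strictly convex on (a,b) then such η* is unique. -/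
open MeasureTheory Filter Set Topology ENNReal
open scoped Classical

noncomputable section

/-- Integration of a function against a finite signed measure, via the Jordan
decomposition. -/
def signedIntegral {S : Type*} [MeasurableSpace S] (μ : MeasureTheory.SignedMeasure S)
    (g : S → ℝ) : ℝ :=
  (∫ x, g x ∂μ.toJordanDecomposition.posPart) - ∫ x, g x ∂μ.toJordanDecomposition.negPart

/-- The weak topology on real-valued functions on `S` generated by the maps
`g ↦ ∫ g dμ` for all finite signed (Borel) measures `μ` on `S`. -/
def weakTop (S : Type*) [MeasurableSpace S] : TopologicalSpace (S → ℝ) :=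
  ⨅ μ : MeasureTheory.SignedMeasure S,
    TopologicalSpace.induced (fun g => signedIntegral μ g) inferInstance

/-- A set `Ψ` of functions is `P(S)`-determining: if two probability measures give the
same integral to every `ψ ∈ Ψ`, then they are equal. -/
def Determining {S : Type*} [MeasurableSpace S] (Ψ : Set (S → ℝ)) : Prop :=
  ∀ Q P : Measure S, IsProbabilityMeasure Q → IsProbabilityMeasure P →
    (∀ ψ ∈ Ψ, (∫ x, ψ x ∂Q) = ∫ x, ψ x ∂P) → Q = P

/-- `Γ ⊆ C_b(S)` is admissible: it contains `0`, is convex, and is closed in `C_b(S)` for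
the weak topology generated by the finite signed measures. -/
def AdmissibleGamma {S : Type*} [TopologicalSpace S] [MeasurableSpace S]
    (Γ : Set (S → ℝ)) : Prop :=
  (fun _ => (0 : ℝ)) ∈ Γ ∧ Convex ℝ Γ ∧ Γ ⊆ Cb S ∧
    ∀ g ∈ Cb S, g ∈ @closure _ (weakTop S) Γ → g ∈ Γ

/-- `Γ` is strictly admissible: there is a `P(S)`-determining set `Ψ ⊆ C_b(S)` such that
for all `ψ ∈ Ψ` there are `c ∈ ℝ` and `ε > 0` with `c ± εψ ∈ Γ`. -/
def StrictlyAdmissibleGamma {S : Type*} [TopologicalSpace S] [MeasurableSpace S]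
    (Γ : Set (S → ℝ)) : Prop :=
  ∃ Ψ : Set (S → ℝ), Ψ ⊆ Cb S ∧ Determining Ψ ∧
    ∀ ψ ∈ Ψ, ∃ c ε : ℝ, 0 < ε ∧
      (fun x => c + ε * ψ x) ∈ Γ ∧ (fun x => c - ε * ψ x) ∈ Γ

/-- `f` is admissible: `f*` is finite everywhere and `lim_{y → -∞} f*(y) < ∞`. -/
def AdmissibleF (f : ℝ → EReal) : Prop :=
  (∀ y : ℝ, fstar f y ≠ ⊤) ∧ ∃ M : ℝ, ∀ᶠ y in Filter.atBot, fstar f y ≤ (M : EReal)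

/-- `f` is strictly convex at `1`: `f` is not affine on any neighborhood of `1`. -/
def StrictlyConvexAtOne (f : ℝ → EReal) : Prop :=
  ∀ ε : ℝ, 0 < ε → ¬ ∃ m q : ℝ, ∀ x : ℝ, |x - 1| < ε → f x = ((m * x + q : ℝ) : EReal)

/-- `f` is strictly convex on the interval `(a,b)` (with `a, b ∈ [-∞,∞]`). -/
def StrictConvexOnAB (a b : EReal) (f : ℝ → EReal) : Prop :=
  ∀ x y t : ℝ, a < (x : EReal) → (x : EReal) < b → a < (y : EReal) → (y : EReal) < b →
    x ≠ y → 0 < t → t < 1 →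
    f (t * x + (1 - t) * y) < ((t : ℝ) : EReal) * f x + (((1 - t : ℝ)) : EReal) * f y

end

open MeasureTheory Filter Set Topology ENNReal

theorem aux_minimax_fin {E ι : Type*} [AddCommGroup E] [Module ℝ E] [Fintype ι]
    (C : Set E) (L : ι → E → ℝ) (hL : ∀ i, ConvexOn ℝ C (L i)) (hC : C.Nonempty)
    (hCc : Convex ℝ C)
    (d : ℝ) (H : ∀ w : ι → ℝ, (∀ i, 0 ≤ w i) → ∑ i, w i = 1 → ∃ r ∈ C, ∑ i, w i * L i r < d) :
    ∃ r ∈ C, ∀ i, L i r < d := by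
  by_contra hcon
  push Not at hcon
  let V : Set (ι → ℝ) := {v | ∀ i, v i < d}
  let U : Set (ι → ℝ) := {v | ∃ r ∈ C, ∀ i, L i r ≤ v i}
  have hVo : IsOpen V := by
    have : V = Set.pi Set.univ (fun _ => Set.Iio d) := by ext v; simp [V]
    rw [this]
    exact isOpen_set_pi Set.finite_univ (fun _ _ => isOpen_Iio)
  have hVc : Convex ℝ V := by
    have : V = Set.pi Set.univ (fun _ => Set.Iio d) := by ext v; simp [V]
    rw [this]
    exact convex_pi (fun _ _ => convex_Iio d)
  have hUc : Convex ℝ U := by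
    rintro v ⟨r, hr, hv⟩ w ⟨s, hs, hw⟩ p q hp hq hpq
    refine ⟨p • r + q • s, hCc hr hs hp hq hpq, fun i => ?_⟩
    have := (hL i).2 hr hs hp hq hpq
    simp only [smul_eq_mul, Pi.add_apply, Pi.smul_apply] at this ⊢
    nlinarith [hv i, hw i]
  have hdis : Disjoint V U := by
    rw [Set.disjoint_left]
    rintro v hv ⟨r, hr, hrv⟩
    obtain ⟨i, hi⟩ := hcon r hr
    linarith [hv i, hrv i]
  obtain ⟨φ, u, hφ1, hφ2⟩ := geometric_hahn_banach_open hVc hVo hUc hdis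
  classical
  have hrep : ∀ v : ι → ℝ, φ v = ∑ i, φ (Pi.single i 1) * v i := by
    intro v
    conv_lhs => rw [pi_eq_sum_univ' v]
    rw [map_sum]
    refine Finset.sum_congr rfl fun i _ => ?_
    rw [map_smul, smul_eq_mul, mul_comm]
  have hw0 : ∀ i, 0 ≤ φ (Pi.single i 1) := by
    intro i
    by_contra hneg
    push Not at hneg
    -- v = (d-1) - t e_i
    have key : ∀ t : ℝ, 0 ≤ t → φ (fun _ => d - 1) - t * φ (Pi.single i 1) < u := by
      intro t ht
      have := hφ1 ((fun _ => d - 1) - t • Pi.single i 1) (by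
        intro j
        by_cases hj : j = i
        · subst hj; simp; linarith
        · simp [hj])
      simpa using this
    set c := φ (Pi.single i 1)
    have := key (|u - φ (fun _ => d - 1)| / (-c)) (div_nonneg (abs_nonneg _) (by linarith))
    have h2 : |u - φ (fun _ => d - 1)| / (-c) * c = - |u - φ (fun _ => d - 1)| := by
      have : c ≠ 0 := hneg.ne
      field_simp
    rw [h2] at this
    linarith [le_abs_self (u - φ (fun _ => d - 1))]
  set W := ∑ i, φ (Pi.single i 1) with hW
  have hWpos : 0 < W := by
    have hWn : 0 ≤ W := Finset.sum_nonneg fun i _ => hw0 i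
    rcases hWn.lt_or_eq with h | h
    · exact h
    · exfalso
      have hz : ∀ i, φ (Pi.single i 1) = 0 := by
        intro i
        exact (Finset.sum_eq_zero_iff_of_nonneg (fun i _ => hw0 i)).1 h.symm i (Finset.mem_univ i)
      obtain ⟨r, hr⟩ := hC
      have h1 := hφ1 (fun _ => d - 1) (fun i => by simp)
      have h2 := hφ2 (fun i => L i r) ⟨r, hr, fun i => le_rfl⟩
      rw [hrep] at h1 h2
      simp [hz] at h1 h2
      linarith
  obtain ⟨r, hr, hlt⟩ := H (fun i => φ (Pi.single i 1) / W) (fun i => div_nonneg (hw0 i) hWpos.le)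
    (by rw [← Finset.sum_div, div_self hWpos.ne'])
  have h2 := hφ2 (fun i => L i r) ⟨r, hr, fun i => le_rfl⟩
  have h3 : W * d ≤ u := by
    refine le_of_forall_pos_lt_add fun ε hε => ?_
    have := hφ1 (fun _ => d - ε / W) (fun i => by have := div_pos hε hWpos; simp; linarith)
    rw [hrep, ← Finset.sum_mul, ← hW, mul_sub, mul_div_cancel₀ _ hWpos.ne'] at this
    linarith
  rw [hrep] at h2
  have h4 : ∑ i, φ (Pi.single i 1) / W * L i r = (∑ i, φ (Pi.single i 1) * L i r) / W := by
    rw [Finset.sum_div]; exact Finset.sum_congr rfl fun i _ => by ring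
  rw [h4, div_lt_iff₀ hWpos] at hlt
  linarith

theorem aux_exp_mid (x y : ℝ) : (Real.exp (-x/2) - Real.exp (-y/2))^2
    = Real.exp (-x) + Real.exp (-y) - 2 * Real.exp (-((x+y)/2)) := by
  have h1 : Real.exp (-x) = Real.exp (-x/2) ^ 2 := by rw [← Real.exp_nat_mul]; congr 1; push_cast; ring
  have h2 : Real.exp (-y) = Real.exp (-y/2) ^ 2 := by rw [← Real.exp_nat_mul]; congr 1; push_cast; ring
  have h3 : Real.exp (-((x+y)/2)) = Real.exp (-x/2) * Real.exp (-y/2) := by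
    rw [← Real.exp_add]; congr 1; ring
  rw [h1, h2, h3]; ring

theorem aux_integrable_exp {Ω : Type*} [MeasurableSpace Ω] (P : Measure Ω) [IsProbabilityMeasure P]
    (r : Ω → ℝ) (hr : Measurable r) (h0 : ∀ x, 0 ≤ r x) : Integrable (fun x => Real.exp (-r x)) P := by
  refine Integrable.of_bound (C := 1) (by fun_prop) (ae_of_all _ fun x => ?_)
  rw [Real.norm_eq_abs, abs_of_pos (Real.exp_pos _)]
  exact Real.exp_le_one_iff.2 (by linarith [h0 x])

theorem aux_int_mid {Ω : Type*} [MeasurableSpace Ω] (P : Measure Ω) [IsProbabilityMeasure P]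
    (r s : Ω → ℝ) (hr : Measurable r) (h0 : ∀ x, 0 ≤ r x) (hs : Measurable s) (hs0 : ∀ x, 0 ≤ s x) :
    ∫ x, (Real.exp (-r x/2) - Real.exp (-s x/2))^2 ∂P
    = ∫ x, Real.exp (-r x) ∂P + ∫ x, Real.exp (-s x) ∂P
      - 2 * ∫ x, Real.exp (-((r x + s x)/2)) ∂P := by
  have h1 := aux_integrable_exp P r hr h0
  have h2 := aux_integrable_exp P s hs hs0
  have h3 := aux_integrable_exp P (fun x => (r x + s x)/2) (by fun_prop)
    (fun x => by have := h0 x; have := hs0 x; positivity)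
  simp_rw [aux_exp_mid]
  have h12 : Integrable (fun x => Real.exp (-r x) + Real.exp (-s x)) P := h1.add h2
  rw [integral_sub h12 (h3.const_mul 2), integral_add h1 h2, integral_const_mul]

/-- A sequence whose `exp(-r/2)` is fast Cauchy in L2 converges a.e. -/
theorem aux_limit {Ω : Type*} [MeasurableSpace Ω] (P : Measure Ω) [IsProbabilityMeasure P]
    (r : ℕ → Ω → ℝ) (hr : ∀ n, Measurable (r n)) (h0 : ∀ n x, 0 ≤ r n x) (M : ℝ≥0∞) (hM : M ≠ ⊤)
    (hrM : ∀ n, ∫⁻ x, ENNReal.ofReal (r n x) ∂P ≤ M)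
    (hc : ∀ N n m, N ≤ n → N ≤ m →
      ∫ x, (Real.exp (-r n x/2) - Real.exp (-r m x/2))^2 ∂P ≤ (1/4)^N) :
    ∃ s : Ω → ℝ, Measurable s ∧ (∀ x, 0 ≤ s x) ∧
      ∀ᵐ x ∂P, Tendsto (fun n => r n x) atTop (𝓝 (s x)) := by
  have hu1 : ∀ n x, Real.exp (-r n x/2) ≤ 1 := fun n x =>
    Real.exp_le_one_iff.2 (by linarith [h0 n x])
  have hconv : ∀ᵐ x ∂P, ∃ l : ℝ, Tendsto (fun n => Real.exp (-r n x/2)) atTop (𝓝 l) := by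
    refine MeasureTheory.Lp.ae_tendsto_of_cauchy_eLpNorm (p := 1) (B := fun n => ENNReal.ofReal (2 * (1/2)^n))
      (fun n => by have := hr n; fun_prop) le_rfl ?_ ?_
    · rw [← ENNReal.ofReal_tsum_of_nonneg (fun n => by positivity)]
      · exact ENNReal.ofReal_ne_top
      · exact (summable_geometric_two).mul_left 2
    · intro N n m hn hm
      have hrn := hr n
      have hrm := hr m
      have hb : ∀ x, |Real.exp (-r n x/2) - Real.exp (-r m x/2)| ≤ 1 := by
        intro x
        rw [abs_le]
        constructor <;> linarith [hu1 n x, hu1 m x, Real.exp_pos (-r n x/2), Real.exp_pos (-r m x/2)]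
      have hi : Integrable (fun x => (Real.exp (-r n x/2) - Real.exp (-r m x/2))) P :=
        Integrable.of_bound (C := 1) (by fun_prop) (ae_of_all _ fun x => by simpa using hb x)
      have hi2 : Integrable (fun x => (Real.exp (-r n x/2) - Real.exp (-r m x/2))^2) P :=
        Integrable.of_bound (C := 1) (by fun_prop) (ae_of_all _ fun x => by
          simpa using hb x)
      rw [eLpNorm_one_eq_lintegral_enorm]
      have : ∫⁻ x, ‖(fun x => Real.exp (-r n x/2)) x - (fun x => Real.exp (-r m x/2)) x‖ₑ ∂P
        = ENNReal.ofReal (∫ x, ‖Real.exp (-r n x/2) - Real.exp (-r m x/2)‖ ∂P) :=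
        (ofReal_integral_norm_eq_lintegral_enorm hi).symm
      simp only [Pi.sub_apply]
      rw [this]
      refine (ENNReal.ofReal_lt_ofReal_iff (by positivity)).2 ?_
      have hle : ∫ x, ‖Real.exp (-r n x/2) - Real.exp (-r m x/2)‖ ∂P
          ≤ ∫ x, ((1/2)^N/2 + 2^N/2 * (Real.exp (-r n x/2) - Real.exp (-r m x/2))^2) ∂P := by
        refine integral_mono hi.norm ((integrable_const _).add (hi2.const_mul _)) fun x => ?_
        simp only [Real.norm_eq_abs]
        set z := Real.exp (-r n x/2) - Real.exp (-r m x/2)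
        have h2 : (0:ℝ) < 2^N := by positivity
        rw [← sq_abs z, one_div, inv_pow]
        have : 0 ≤ ((2:ℝ)^N)⁻¹ * (2^N * |z| - 1)^2 := by positivity
        have e : ((2:ℝ)^N)⁻¹ * (2^N * |z| - 1)^2 = 2^N * |z|^2 - 2 * |z| + ((2:ℝ)^N)⁻¹ := by
          field_simp
          ring
        rw [e] at this
        linarith
      rw [integral_add (integrable_const _) (hi2.const_mul _), integral_const_mul] at hle
      simp only [integral_const, probReal_univ, one_smul] at hle
      have hcc := hc N n m hn hm
      have : (2:ℝ)^N/2 * (1/4)^N = (1/2)^N/2 := by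
        rw [div_mul_eq_mul_div, ← mul_pow]; norm_num
      have h3 : (2:ℝ)^N/2 * ∫ x, (Real.exp (-r n x/2) - Real.exp (-r m x/2))^2 ∂P ≤ (1/2)^N/2 := by
        rw [← this]; gcongr
      have : (0:ℝ) < (1/2)^N := by positivity
      linarith
  have hfat : ∀ᵐ x ∂P, liminf (fun n => ENNReal.ofReal (r n x)) atTop < ⊤ := by
    refine ae_lt_top (Measurable.liminf fun n => (hr n).ennreal_ofReal) (ne_top_of_le_ne_top hM ?_)
    refine (lintegral_liminf_le fun n => (hr n).ennreal_ofReal).trans ?_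
    exact liminf_le_of_le (by isBoundedDefault) (fun b hb => by
      obtain ⟨n, hn⟩ := hb.exists
      exact hn.trans (hrM n))
  have hconv2 : ∀ᵐ x ∂P, ∃ l : ℝ, Tendsto (fun n => r n x) atTop (𝓝 l) := by
    filter_upwards [hconv, hfat] with x ⟨l, hl⟩ hx
    have hl0 : 0 ≤ l := ge_of_tendsto' hl fun n => (Real.exp_pos _).le
    have e : ∀ n, r n x = -2 * Real.log (Real.exp (-r n x/2)) := fun n => by
      rw [Real.log_exp]; ring
    rcases hl0.lt_or_eq with h | h
    · refine ⟨-2 * Real.log l, ?_⟩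
      have := ((Real.continuousAt_log h.ne').tendsto.comp hl).const_mul (-2)
      refine this.congr fun n => (e n).symm
    · exfalso
      subst h
      have h1 : Tendsto (fun n => Real.exp (-r n x/2)) atTop (𝓝[>] 0) :=
        tendsto_nhdsWithin_iff.2 ⟨hl, Eventually.of_forall fun n => Real.exp_pos _⟩
      have h2 := Real.tendsto_log_nhdsGT_zero.comp h1
      have h3 : Tendsto (fun n => r n x) atTop atTop := by
        have := h2.const_mul_atBot_of_neg (show (-2:ℝ) < 0 by norm_num)
        exact this.congr fun n => (e n).symm
      have h4 := (ENNReal.tendsto_ofReal_atTop.comp h3).liminf_eq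
      simp only [Function.comp_def] at h4
      rw [h4] at hx
      exact lt_irrefl _ hx
  obtain ⟨s, hsm, hs⟩ := measurable_limit_of_tendsto_metrizable_ae
    (fun n => (hr n).aemeasurable) hconv2
  refine ⟨fun x => max (s x) 0, hsm.max measurable_const, fun x => le_max_right _ _, ?_⟩
  filter_upwards [hs] with x hx
  rw [max_eq_left (ge_of_tendsto' hx fun n => h0 n x)]
  exact hx

theorem aux_compact {Ω I : Type*} [MeasurableSpace Ω] (P : Measure Ω) [IsProbabilityMeasure P]
    [SemilatticeSup I] (C : I → Set (Ω → ℝ)) (hanti : Antitone C) (hne : ∀ i, (C i).Nonempty)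
    (hmeas : ∀ i, ∀ r ∈ C i, Measurable r ∧ ∀ x, 0 ≤ r x)
    (hmid : ∀ i, ∀ r ∈ C i, ∀ s ∈ C i, (fun x => (r x + s x)/2) ∈ C i)
    (hclosed : ∀ i, ∀ r : ℕ → Ω → ℝ, (∀ n, r n ∈ C i) → ∀ s : Ω → ℝ, Measurable s → (∀ x, 0 ≤ s x) →
      (∀ᵐ x ∂P, Tendsto (fun n => r n x) atTop (𝓝 (s x))) → s ∈ C i)
    (i0 : I) (M : ℝ≥0∞) (hM : M ≠ ⊤)
    (hb : ∀ r ∈ C i0, ∫⁻ x, ENNReal.ofReal (r x) ∂P ≤ M) :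
    ∃ r, ∀ i, r ∈ C i := by
  let ψ : (Ω → ℝ) → ℝ := fun r => ∫ x, Real.exp (-r x) ∂P
  have hψ0 : ∀ r, 0 ≤ ψ r := fun r => integral_nonneg fun x => (Real.exp_pos _).le
  have hψ1 : ∀ r : Ω → ℝ, Measurable r → (∀ x, 0 ≤ r x) → ψ r ≤ 1 := by
    intro r hr h0
    have := integral_mono (aux_integrable_exp P r hr h0) (integrable_const (1:ℝ)) (fun x =>
      Real.exp_le_one_iff.2 (by linarith [h0 x]))
    simpa [ψ] using this
  let m : I → ℝ := fun i => sInf (ψ '' C i)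
  have hbdd : ∀ i, BddBelow (ψ '' C i) := fun i => ⟨0, by rintro _ ⟨r, _, rfl⟩; exact hψ0 r⟩
  have hmle : ∀ i, ∀ r ∈ C i, m i ≤ ψ r := fun i r hr => csInf_le (hbdd i) ⟨r, hr, rfl⟩
  have hm1 : ∀ i, m i ≤ 1 := by
    intro i
    obtain ⟨r, hr⟩ := hne i
    exact (hmle i r hr).trans (hψ1 r (hmeas i r hr).1 (hmeas i r hr).2)
  have hmmono : Monotone m := fun i j hij =>
    csInf_le_csInf (hbdd i) ((hne j).image _) (image_mono (hanti hij))
  have hmb : BddAbove (range m) := ⟨1, by rintro _ ⟨i, rfl⟩; exact hm1 i⟩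
  have : Nonempty I := ⟨i0⟩
  set μ := ⨆ i, m i with hμ
  have hmμ : ∀ i, m i ≤ μ := fun i => le_ciSup hmb i
  have hk : ∀ n : ℕ, ∃ k, μ - (1/4)^n/4 < m k := by
    intro n
    exact exists_lt_of_lt_ciSup (by have : (0:ℝ) < (1/4)^n := by positivity
                                    linarith)
  choose k hk using hk
  let i : ℕ → I := fun n => partialSups k n
  have himono : Monotone i := (partialSups k).monotone
  have hi : ∀ n j, μ - (1/4)^n/4 < m (i n ⊔ j) := fun n j =>
    (hk n).trans_le (hmmono ((le_partialSups k n).trans le_sup_left))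
  have claim : ∀ j, i0 ≤ j → ∃ s, (∀ n, s ∈ C (i n ⊔ j)) ∧ ψ s ≤ μ := by
    intro j hj
    have hr : ∀ n : ℕ, ∃ r ∈ C (i n ⊔ j), ψ r < μ + (1/4)^n/4 := by
      intro n
      have : sInf (ψ '' C (i n ⊔ j)) < μ + (1/4)^n/4 :=
        (hmμ (i n ⊔ j)).trans_lt (by have : (0:ℝ) < (1/4)^n := by positivity
                                     linarith)
      obtain ⟨_, ⟨r, hr, rfl⟩, h⟩ := exists_lt_of_csInf_lt ((hne _).image _) this
      exact ⟨r, hr, h⟩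
    choose r hrC hrψ using hr
    have hin : ∀ N n, N ≤ n → r n ∈ C (i N ⊔ j) := fun N n h =>
      hanti (sup_le_sup_right (himono h) j) (hrC n)
    have hrm : ∀ n, Measurable (r n) := fun n => (hmeas _ _ (hrC n)).1
    have hr0 : ∀ n x, 0 ≤ r n x := fun n => (hmeas _ _ (hrC n)).2
    obtain ⟨s, hsm, hs0, hs⟩ := aux_limit P r hrm hr0 M hM
      (fun n => hb _ (hanti (hj.trans le_sup_right) (hrC n))) (by
        intro N n p hn hp
        rw [aux_int_mid P _ _ (hrm n) (hr0 n) (hrm p) (hr0 p)]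
        have h1 := hmle _ _ (hmid _ _ (hin N n hn) _ (hin N p hp))
        have h2 := hi N j
        have h3 : ψ (r n) < μ + (1/4)^N/4 := (hrψ n).trans_le (by
          have : ((1/4:ℝ))^n ≤ (1/4)^N := pow_le_pow_of_le_one (by norm_num) (by norm_num) hn
          linarith)
        have h4 : ψ (r p) < μ + (1/4)^N/4 := (hrψ p).trans_le (by
          have : ((1/4:ℝ))^p ≤ (1/4)^N := pow_le_pow_of_le_one (by norm_num) (by norm_num) hp
          linarith)
        simp only [ψ] at h1 h3 h4
        linarith)
    refine ⟨s, fun n => ?_, ?_⟩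
    · refine hclosed _ (fun p => r (p + n)) (fun p => hin n (p+n) (by omega)) s hsm hs0 ?_
      filter_upwards [hs] with x hx
      exact hx.comp (tendsto_add_atTop_nat n)
    · have ht : Tendsto (fun n => ψ (r n)) atTop (𝓝 (ψ s)) := by
        refine tendsto_integral_of_dominated_convergence (fun _ => 1)
          (fun n => (aux_integrable_exp P _ (hrm n) (hr0 n)).1) (integrable_const _) ?_ ?_
        · intro n
          refine ae_of_all _ fun x => ?_
          rw [Real.norm_eq_abs, abs_of_pos (Real.exp_pos _)]
          exact Real.exp_le_one_iff.2 (by linarith [hr0 n x])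
        · filter_upwards [hs] with x hx
          exact (Real.continuous_exp.tendsto _).comp hx.neg
      have ht2 : Tendsto (fun n : ℕ => μ + (1/4:ℝ)^n/4) atTop (𝓝 (μ + 0/4)) :=
        ((_root_.tendsto_pow_atTop_nhds_zero_of_lt_one (by norm_num) (by norm_num)).div_const 4).const_add μ
      have := le_of_tendsto_of_tendsto' ht ht2 (fun n => (hrψ n).le)
      simpa using this
  obtain ⟨r, hrC, hrψ⟩ := claim i0 le_rfl
  refine ⟨r, fun j => ?_⟩
  obtain ⟨s, hsC, hsψ⟩ := claim (i0 ⊔ j) le_sup_left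
  have hsC' : ∀ n, s ∈ C (i n ⊔ i0) := fun n => hanti (sup_le_sup_left le_sup_left _) (hsC n)
  obtain ⟨hrm, hr0⟩ := hmeas _ _ (hrC 0)
  obtain ⟨hsm, hs0⟩ := hmeas _ _ (hsC 0)
  have hmidψ : μ ≤ ψ (fun x => (r x + s x)/2) := by
    have ht2 : Tendsto (fun n : ℕ => μ - (1/4:ℝ)^n/4) atTop (𝓝 (μ - 0/4)) :=
        ((_root_.tendsto_pow_atTop_nhds_zero_of_lt_one (by norm_num) (by norm_num)).div_const 4).const_sub μ
    have := le_of_tendsto' ht2 (fun n => (hi n i0).le.trans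
      (hmle _ _ (hmid _ _ (hrC n) _ (hsC' n))))
    simpa using this
  have hint := aux_int_mid P r s hrm hr0 hsm hs0
  have hz : ∫ x, (Real.exp (-r x/2) - Real.exp (-s x/2))^2 ∂P = 0 := by
    refine le_antisymm ?_ (integral_nonneg fun x => sq_nonneg _)
    simp only [ψ] at hrψ hsψ hmidψ
    linarith
  have hi2 : Integrable (fun x => (Real.exp (-r x/2) - Real.exp (-s x/2))^2) P := by
    refine Integrable.of_bound (C := 1) (by fun_prop) (ae_of_all _ fun x => ?_)
    have h1 : Real.exp (-r x/2) ≤ 1 := Real.exp_le_one_iff.2 (by linarith [hr0 x])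
    have h2 : Real.exp (-s x/2) ≤ 1 := Real.exp_le_one_iff.2 (by linarith [hs0 x])
    have : |Real.exp (-r x/2) - Real.exp (-s x/2)| ≤ 1 := by
      rw [abs_le]
      constructor <;> linarith [Real.exp_pos (-r x/2), Real.exp_pos (-s x/2)]
    simpa using this
  rw [integral_eq_zero_iff_of_nonneg (fun x => sq_nonneg _) hi2] at hz
  refine hanti (le_sup_right.trans le_sup_right) (hclosed (i 0 ⊔ (i0 ⊔ j)) (fun _ => s)
    (fun _ => hsC 0) r hrm hr0 ?_)
  filter_upwards [hz] with x hx
  have : r x = s x := by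
    have := Real.exp_injective (sub_eq_zero.1 (pow_eq_zero_iff (two_ne_zero) |>.1 hx))
    linarith
  rw [this]
  exact tendsto_const_nhds

noncomputable def auxphi (f : ℝ → EReal) (y : ℝ) : ℝ := (fstar f y).toReal

noncomputable def auxK (f : ℝ → EReal) (y s : ℝ) : ℝ≥0∞ :=
  (f s + ((auxphi f y - y * s : ℝ) : EReal)).toENNReal

section fprops
variable {a b : EReal} {f : ℝ → EReal}

theorem aux_real (hf : IsF1 a b f) {x : ℝ} (h : f x ≠ ⊤) : ∃ v : ℝ, f x = v :=
  ⟨(f x).toReal, (EReal.coe_toReal h (hf.ne_bot x)).symm⟩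

theorem aux_term_le (f : ℝ → EReal) (x y : ℝ) : (((x * y : ℝ) : EReal) - f x) ≤ fstar f y :=
  le_iSup (fun x : ℝ => (((x * y : ℝ) : EReal) - f x)) x

theorem aux_phi_coe (hf : IsF1 a b f) (hfa : AdmissibleF f) (y : ℝ) :
    fstar f y = (auxphi f y : EReal) := by
  refine (EReal.coe_toReal (hfa.1 y) ?_).symm
  have := aux_term_le f 1 y
  rw [hf.at_one] at this
  intro h
  rw [h] at this
  simp at this

theorem aux_young (hf : IsF1 a b f) (hfa : AdmissibleF f) {x v : ℝ} (hv : f x = v) (y : ℝ) :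
    x * y - v ≤ auxphi f y := by
  have := aux_term_le f x y
  rw [hv, aux_phi_coe hf hfa] at this
  exact_mod_cast this

theorem aux_near (hf : IsF1 a b f) (hfa : AdmissibleF f) (y δ : ℝ) (hδ : 0 < δ) :
    ∃ x v : ℝ, f x = v ∧ auxphi f y - δ < x * y - v := by
  have h : ((auxphi f y - δ : ℝ) : EReal) < fstar f y := by
    rw [aux_phi_coe hf hfa]
    exact_mod_cast (by linarith)
  obtain ⟨x, hx⟩ := lt_iSup_iff.1 h
  have hx' : f x ≠ ⊤ := by
    intro h; rw [h] at hx; simp at hx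
  obtain ⟨v, hv⟩ := aux_real hf hx'
  refine ⟨x, v, hv, ?_⟩
  rw [hv] at hx
  exact_mod_cast hx

theorem aux_neg (hf : IsF1 a b f) (hfa : AdmissibleF f) {x v : ℝ} (hv : f x = v) : 0 ≤ x := by
  by_contra hx
  push Not at hx
  obtain ⟨M, hM⟩ := hfa.2
  obtain ⟨y, hy1, hy2⟩ := (hM.and (eventually_lt_atBot ((M + v) / x))).exists
  rw [aux_phi_coe hf hfa] at hy1
  have h1 : auxphi f y ≤ M := by exact_mod_cast hy1
  have h2 := aux_young hf hfa hv y
  rw [lt_div_iff_of_neg hx] at hy2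
  linarith

theorem aux_conv (hf : IsF1 a b f) {x y v w : ℝ} (hv : f x = v) (hw : f y = w) {t : ℝ}
    (h0 : 0 ≤ t) (h1 : t ≤ 1) :
    ∃ u : ℝ, f (t * x + (1 - t) * y) = u ∧ u ≤ t * v + (1 - t) * w := by
  rcases h0.eq_or_lt with rfl | h0
  · exact ⟨w, by simpa using hw, by simp⟩
  rcases h1.eq_or_lt with rfl | h1
  · exact ⟨v, by simpa using hv, by simp⟩
  have := hf.convex x y t h0 h1
  rw [hv, hw] at this
  have h2 : f (t * x + (1 - t) * y) ≠ ⊤ := by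
    intro h
    rw [h, top_le_iff] at this
    exact EReal.coe_ne_top (t * v + (1 - t) * w) (by exact_mod_cast this)
  obtain ⟨u, hu⟩ := aux_real hf h2
  refine ⟨u, hu, ?_⟩
  rw [hu] at this
  exact_mod_cast this

theorem aux_mid (hf : IsF1 a b f) {x y v w : ℝ} (hv : f x = v) (hw : f y = w) :
    ∃ u : ℝ, f ((x + y) / 2) = u ∧ u ≤ (v + w) / 2 := by
  obtain ⟨u, hu, h⟩ := aux_conv hf hv hw (t := 1/2) (by norm_num) (by norm_num)
  refine ⟨u, ?_, by linarith⟩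
  rw [← hu]; congr 1; ring

theorem aux_phi_convex (hf : IsF1 a b f) (hfa : AdmissibleF f) : ConvexOn ℝ univ (auxphi f) := by
  refine ⟨convex_univ, fun y _ z _ p q hp hq hpq => ?_⟩
  have : fstar f (p * y + q * z) ≤ ((p * auxphi f y + q * auxphi f z : ℝ) : EReal) := by
    refine iSup_le fun x => ?_
    by_cases hx : f x = ⊤
    · rw [hx]; simp
    obtain ⟨v, hv⟩ := aux_real hf hx
    rw [hv]
    have h1 := aux_young hf hfa hv y
    have h2 := aux_young hf hfa hv z
    have : x * (p * y + q * z) - v ≤ p * auxphi f y + q * auxphi f z := by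
      have : v = p * v + q * v := by rw [← add_mul, hpq, one_mul]
      nlinarith
    exact_mod_cast this
  rw [aux_phi_coe hf hfa] at this
  simp only [smul_eq_mul]
  exact_mod_cast this

theorem aux_phi_cont (hf : IsF1 a b f) (hfa : AdmissibleF f) : Continuous (auxphi f) := by
  rw [← continuousOn_univ]
  exact (aux_phi_convex hf hfa).continuousOn isOpen_univ

theorem aux_subgrad (hf : IsF1 a b f) : ∃ c : ℝ, ∀ x v : ℝ, f x = v → c * (x - 1) ≤ v := by
  let D : Set ℝ := {x | f x ≠ ⊤}
  let F : ℝ → ℝ := fun x => (f x).toReal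
  have hFc : ConvexOn ℝ D F := by
    have key : ∀ x ∈ D, ∀ y ∈ D, ∀ p q : ℝ, 0 ≤ p → 0 ≤ q → p + q = 1 →
        ∃ u : ℝ, f (p * x + q * y) = u ∧ u ≤ p * F x + q * F y := by
      intro x hx y hy p q hp hq hpq
      obtain ⟨v, hv⟩ := aux_real hf hx
      obtain ⟨w, hw⟩ := aux_real hf hy
      obtain ⟨u, hu, h⟩ := aux_conv hf hv hw hp (by linarith)
      have : q = 1 - p := by linarith
      subst this
      exact ⟨u, hu, by simpa [F, hv, hw] using h⟩
    refine ⟨fun x hx y hy p q hp hq hpq => ?_, fun x hx y hy p q hp hq hpq => ?_⟩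
    · obtain ⟨u, hu, h⟩ := key x hx y hy p q hp hq hpq
      simp [D, hu]
    · obtain ⟨u, hu, h⟩ := key x hx y hy p q hp hq hpq
      simp only [smul_eq_mul]
      simpa [F, hu] using h
  have hint : (1:ℝ) ∈ interior D := by
    rw [mem_interior]
    refine ⟨(fun x : ℝ => (x : EReal)) ⁻¹' Ioo a b, fun x hx => hf.finite_on x hx.1 hx.2,
      isOpen_Ioo.preimage continuous_coe_real_ereal, hf.a_lt_one, hf.one_lt_b⟩
  have hF1 : F 1 = 0 := by simp [F, hf.at_one]
  refine ⟨derivWithin F (Ioi 1) 1, fun x v hv => ?_⟩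
  have hxD : x ∈ D := by simp [D, hv]
  have hFx : F x = v := by simp [F, hv]
  rcases lt_trichotomy x 1 with h | h | h
  · have h1 := hFc.slope_le_leftDeriv_of_mem_interior hxD hint h
    have h2 := hFc.leftDeriv_le_rightDeriv_of_mem_interior hint
    have h3 := h1.trans h2
    rw [slope_def_field, hF1, hFx, div_le_iff₀ (by linarith)] at h3
    linarith
  · subst h
    rw [hf.at_one] at hv
    have : (0:ℝ) = v := by exact_mod_cast hv
    rw [← this]; simp
  · have h1 := hFc.rightDeriv_le_slope_of_mem_interior hint hxD h
    rw [slope_def_field, hF1, hFx, le_div_iff₀ (by linarith)] at h1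
    linarith

theorem aux_K_coe (hf : IsF1 a b f) {s v : ℝ} (hv : f s = v) (y : ℝ) :
    auxK f y s = ENNReal.ofReal (v + (auxphi f y - y * s)) := by
  rw [auxK, hv, ← EReal.coe_add, EReal.real_coe_toENNReal]

theorem aux_K_top {s : ℝ} (hv : f s = ⊤) (y : ℝ) :
    auxK f y s = ⊤ := by
  rw [auxK, hv, EReal.top_add_coe, EReal.toENNReal_top]

theorem aux_K_mid (hf : IsF1 a b f) (hfa : AdmissibleF f) (y r s : ℝ) :
    auxK f y ((r + s) / 2) ≤ (auxK f y r + auxK f y s) / 2 := by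
  by_cases hr : f r = ⊤
  · rw [aux_K_top hr, top_add, ENNReal.top_div_of_ne_top (by norm_num)]; exact le_top
  by_cases hs : f s = ⊤
  · rw [aux_K_top hs, add_top, ENNReal.top_div_of_ne_top (by norm_num)]; exact le_top
  obtain ⟨v, hv⟩ := aux_real hf hr
  obtain ⟨w, hw⟩ := aux_real hf hs
  obtain ⟨u, hu, h⟩ := aux_mid hf hv hw
  have h1 := aux_young hf hfa hv y
  have h2 := aux_young hf hfa hw y
  rw [aux_K_coe hf hv, aux_K_coe hf hw, aux_K_coe hf hu,
    ← ENNReal.ofReal_add (by linarith) (by linarith)]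
  rw [show (2:ℝ≥0∞) = ENNReal.ofReal 2 by simp, ← ENNReal.ofReal_div_of_pos (by norm_num)]
  refine ENNReal.ofReal_le_ofReal ?_
  linarith

theorem aux_K_lsc (hf : IsF1 a b f) (y : ℝ) : LowerSemicontinuous (auxK f y) := by
  unfold auxK
  refine EReal.continuous_toENNReal.comp_lowerSemicontinuous ?_
    (fun x y h => EReal.toENNReal_le_toENNReal h)
  refine LowerSemicontinuous.add' hf.lsc ?_ ?_
  · exact Continuous.lowerSemicontinuous
      (continuous_coe_real_ereal.comp (by fun_prop))
  · intro x
    exact EReal.continuousAt_add (Or.inr (EReal.coe_ne_bot _)) (Or.inr (EReal.coe_ne_top _))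

theorem aux_K_meas (hf : IsF1 a b f) (hfa : AdmissibleF f) {Ω : Type*} [MeasurableSpace Ω]
    {h r : Ω → ℝ} (hh : Measurable h) (hr : Measurable r) :
    Measurable (fun x => auxK f (h x) (r x)) := by
  unfold auxK
  have h1 : Measurable (fun x => f (r x)) := hf.lsc.measurable.comp hr
  have h2 := (aux_phi_cont hf hfa).measurable.comp hh
  have h3 : Measurable (fun x => ((auxphi f (h x) - h x * r x : ℝ) : EReal)) :=
    (h2.sub (hh.mul hr)).coe_real_ereal
  exact (h1.add h3).ereal_toENNReal

theorem aux_K_bound (hf : IsF1 a b f) (hfa : AdmissibleF f) (y s : ℝ) :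
    ENNReal.ofReal s ≤ auxK f y s + ENNReal.ofReal (|auxphi f (y+1) - auxphi f y|) := by
  by_cases hs : f s = ⊤
  · rw [aux_K_top hs, top_add]; exact le_top
  obtain ⟨v, hv⟩ := aux_real hf hs
  have h1 := aux_young hf hfa hv y
  have h2 := aux_young hf hfa hv (y+1)
  rw [aux_K_coe hf hv, ← ENNReal.ofReal_add (by linarith) (abs_nonneg _)]
  refine ENNReal.ofReal_le_ofReal ?_
  have := le_abs_self (auxphi f (y+1) - auxphi f y)
  linarith

theorem aux_select (hf : IsF1 a b f) (hfa : AdmissibleF f) (δ : ℝ) (hδ : 0 < δ) :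
    ∃ ρ : ℝ → ℝ, Measurable ρ ∧ ∀ y, ∃ v : ℝ, f (ρ y) = v ∧ auxphi f y - δ < ρ y * y - v := by
  choose X V hXV hlt using fun y => aux_near hf hfa y δ hδ
  let U : ℝ → Set ℝ := fun y => {z | auxphi f z - δ < X y * z - V y}
  have hUo : ∀ y, IsOpen (U y) := fun y =>
    isOpen_lt ((aux_phi_cont hf hfa).sub continuous_const) (by fun_prop)
  obtain ⟨s, hs, hcov⟩ := TopologicalSpace.countable_cover_nhds
    (fun y => (hUo y).mem_nhds (hlt y) : ∀ y, U y ∈ 𝓝 y)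
  have hsne : s.Nonempty := by
    by_contra h
    rw [not_nonempty_iff_eq_empty] at h
    subst h
    simp only [mem_empty_iff_false, iUnion_of_empty, iUnion_empty] at hcov
    exact empty_ne_univ hcov
  obtain ⟨e, he⟩ := hs.exists_eq_range hsne
  have hex : ∀ y, ∃ n, y ∈ U (e n) := by
    intro y
    have : y ∈ ⋃ x ∈ s, U x := by rw [hcov]; trivial
    simp only [mem_iUnion] at this
    obtain ⟨x, hx, hy⟩ := this
    rw [he] at hx
    obtain ⟨n, rfl⟩ := hx
    exact ⟨n, hy⟩
  refine ⟨fun y => X (e (Nat.find (hex y))), ?_, fun y => ⟨V (e (Nat.find (hex y))), hXV _, ?_⟩⟩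
  · have : Measurable (fun y => Nat.find (hex y)) := measurable_find hex (fun n => (hUo _).measurableSet)
    exact (measurable_from_nat (f := fun n => X (e n))).comp this
  · exact Nat.find_spec (hex y)

end fprops

theorem aux_eInt {Ω : Type*} [MeasurableSpace Ω] (P : Measure Ω) (h : Ω → EReal) (u : Ω → ℝ)
    (hh : Measurable h) (hu : Integrable u P) (hnn : ∀ x, 0 ≤ h x + (u x : EReal)) :
    eIntegral P h + ((∫ x, u x ∂P : ℝ) : EReal)
      = ((∫⁻ x, (h x + (u x : EReal)).toENNReal ∂P : ℝ≥0∞) : EReal) := by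
  have hpos : ∀ x : EReal, posE x = x.toENNReal := fun x => rfl
  have hpt : ∀ x, posE (h x) + ENNReal.ofReal (u x)
      = ((h x + (u x : EReal)).toENNReal + ENNReal.ofReal (-u x)) + posE (-(h x)) := by
    intro x
    have hx := hnn x
    simp only [hpos]
    induction hxv : h x with
    | bot => rw [hxv] at hx; simp at hx
    | top => simp
    | coe v =>
      rw [hxv] at hx
      have hx' : 0 ≤ v + u x := by exact_mod_cast hx
      rw [← EReal.coe_add, ← EReal.coe_neg]
      simp only [EReal.real_coe_toENNReal]
      rcases le_total 0 v with h1 | h1 <;> rcases le_total 0 (u x) with h2 | h2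
      · rw [ENNReal.ofReal_of_nonpos (p := -u x) (by linarith),
          ENNReal.ofReal_of_nonpos (p := -v) (by linarith), ENNReal.ofReal_add h1 h2]; simp
      · rw [ENNReal.ofReal_of_nonpos (p := u x) (by linarith),
          ENNReal.ofReal_of_nonpos (p := -v) (by linarith),
          ← ENNReal.ofReal_add hx' (by linarith)]; simp
      · rw [ENNReal.ofReal_of_nonpos (p := -u x) (by linarith),
          ENNReal.ofReal_of_nonpos (p := v) (by linarith), add_zero,
          ← ENNReal.ofReal_add hx' (by linarith)]; simp
      · have e1 : v = 0 := by linarith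
        have e2 : u x = 0 := by linarith
        simp [e1, e2]
  have hle : ∀ x, posE (-(h x)) ≤ ENNReal.ofReal (u x) := by
    intro x
    have hx := hnn x
    simp only [hpos]
    induction hxv : h x with
    | bot => rw [hxv] at hx; simp at hx
    | top => simp
    | coe v =>
      rw [hxv] at hx
      have hx' : 0 ≤ v + u x := by exact_mod_cast hx
      rw [← EReal.coe_neg, EReal.real_coe_toENNReal]
      exact ENNReal.ofReal_le_ofReal (by linarith)
  have hm1 : Measurable (fun x => posE (-(h x))) := (hh.neg).ereal_toENNReal
  have hm2 : Measurable (fun x => posE (h x)) := hh.ereal_toENNReal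
  have hum := hu.1.aemeasurable
  have hI : ∫⁻ x, posE (h x) ∂P + ∫⁻ x, ENNReal.ofReal (u x) ∂P
      = (∫⁻ x, (h x + (u x : EReal)).toENNReal ∂P + ∫⁻ x, ENNReal.ofReal (-u x) ∂P)
        + ∫⁻ x, posE (-(h x)) ∂P := by
    have hneg : AEMeasurable (fun x => ENNReal.ofReal (-u x)) P := hum.neg.ennreal_ofReal
    rw [← lintegral_add_left hm2, ← lintegral_add_right' _ hneg,
      ← lintegral_add_right _ hm1]
    exact lintegral_congr hpt
  have hB : ∫⁻ x, posE (-(h x)) ∂P ≤ ∫⁻ x, ENNReal.ofReal (u x) ∂P := lintegral_mono hle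
  have hU1 : ∫⁻ x, ENNReal.ofReal (u x) ∂P ≠ ⊤ := hu.lintegral_lt_top.ne
  have hU2 : ∫⁻ x, ENNReal.ofReal (-u x) ∂P ≠ ⊤ := hu.neg.lintegral_lt_top.ne
  have hB1 := ne_top_of_le_ne_top hU1 hB
  rw [integral_eq_lintegral_pos_part_sub_lintegral_neg_part hu, eIntegral]
  generalize ∫⁻ x, posE (h x) ∂P = A at *
  generalize ∫⁻ x, posE (-(h x)) ∂P = B at *
  generalize ∫⁻ x, ENNReal.ofReal (u x) ∂P = U at *
  generalize ∫⁻ x, ENNReal.ofReal (-u x) ∂P = V at *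
  generalize ∫⁻ x, (h x + (u x : EReal)).toENNReal ∂P = K at *
  lift B to NNReal using hB1
  lift U to NNReal using hU1
  lift V to NNReal using hU2
  by_cases hA : A = ⊤
  · subst hA
    have : K = ⊤ := by
      by_contra hK
      lift K to NNReal using hK
      rw [top_add] at hI
      exact ENNReal.coe_ne_top (r := K + V + B) (by rw [hI]; push_cast; rfl)
    subst this
    have e : ((B : ℝ≥0∞) : EReal) = ((B : ℝ) : EReal) := rfl
    rw [EReal.coe_ennreal_top, e, EReal.top_sub_coe, EReal.top_add_coe]
  · lift A to NNReal using hA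
    have hK : K ≠ ⊤ := by
      intro hK
      subst hK
      rw [top_add, top_add] at hI
      exact ENNReal.coe_ne_top (r := A + U) (by rw [← hI]; push_cast; rfl)
    lift K to NNReal using hK
    have hI' : (A:ℝ) + U = K + V + B := by exact_mod_cast hI
    have e : ∀ z : NNReal, ((z : ℝ≥0∞) : EReal) = ((z : ℝ) : EReal) := fun _ => rfl
    simp only [e, ENNReal.coe_toReal]
    rw [← EReal.coe_sub, ← EReal.coe_add]
    congr 1
    linarith

theorem aux_eInt_real {Ω : Type*} [MeasurableSpace Ω] (P : Measure Ω) (u : Ω → ℝ)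
    (hum : Measurable u) (hu : Integrable u P) :
    eIntegral P (fun x => (u x : EReal)) = ((∫ x, u x ∂P : ℝ) : EReal) := by
  have := aux_eInt P (fun x => (u x : EReal)) (fun x => - u x) hum.coe_real_ereal hu.neg
    (fun x => by rw [← EReal.coe_add]; simp)
  simp only [← EReal.coe_add] at this
  simp only [add_neg_cancel, EReal.coe_zero, EReal.toENNReal_zero, lintegral_zero,
    EReal.coe_ennreal_zero, integral_neg] at this
  generalize eIntegral P (fun x => (u x : EReal)) = E at *
  induction E with
  | bot => simp at this
  | top => simp [-EReal.coe_neg] at this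
  | coe v =>
    have h : v + -∫ x, u x ∂P = 0 := by exact_mod_cast this
    congr 1; linarith

section main
variable {a b : EReal} {f : ℝ → EReal} {Ω : Type*} [MeasurableSpace Ω]

theorem aux_Mb_int {h : Ω → ℝ} (hh : h ∈ Mb Ω) (P : Measure Ω) [IsProbabilityMeasure P] :
    Integrable h P := by
  obtain ⟨C, hC⟩ := hh.2
  exact Integrable.of_bound (C := C) hh.1.aestronglyMeasurable (ae_of_all _ hC)

theorem aux_phi_bdd (hf : IsF1 a b f) (hfa : AdmissibleF f) (C : ℝ) :
    ∃ B, ∀ y, |y| ≤ C → |auxphi f y| ≤ B := by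
  obtain ⟨B, hB⟩ := (isCompact_Icc (a := -C) (b := C)).exists_bound_of_continuousOn
    (aux_phi_cont hf hfa).continuousOn
  exact ⟨B, fun y hy => hB y (abs_le.1 hy)⟩

theorem aux_phi_Mb (hf : IsF1 a b f) (hfa : AdmissibleF f) {h : Ω → ℝ} (hh : h ∈ Mb Ω) :
    (fun x => auxphi f (h x)) ∈ Mb Ω := by
  obtain ⟨C, hC⟩ := hh.2
  obtain ⟨B, hB⟩ := aux_phi_bdd hf hfa C
  exact ⟨(aux_phi_cont hf hfa).measurable.comp hh.1, B, fun x => hB _ (hC x)⟩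

theorem aux_Mb_mul_int {h : Ω → ℝ} (hh : h ∈ Mb Ω) {P : Measure Ω} {r : Ω → ℝ}
    (hr : Integrable r P) : Integrable (fun x => h x * r x) P := by
  obtain ⟨C, hC⟩ := hh.2
  exact hr.bdd_mul (c := C) hh.1.aestronglyMeasurable (ae_of_all _ hC)

theorem aux_Phi (hf : IsF1 a b f) (hfa : AdmissibleF f) (P : Measure Ω) [IsProbabilityMeasure P]
    {h r : Ω → ℝ} (hh : h ∈ Mb Ω) (hrm : Measurable r) (hr : Integrable r P) :
    eIntegral P (fun x => f (r x)) + ((∫ x, (auxphi f (h x) - h x * r x) ∂P : ℝ) : EReal)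
      = ((∫⁻ x, auxK f (h x) (r x) ∂P : ℝ≥0∞) : EReal) := by
  refine aux_eInt P (fun x => f (r x)) (fun x => auxphi f (h x) - h x * r x)
    (hf.lsc.measurable.comp hrm)
    ((aux_Mb_int (aux_phi_Mb hf hfa hh) P).sub (aux_Mb_mul_int hh hr)) fun x => ?_
  by_cases hx : f (r x) = ⊤
  · rw [hx, EReal.top_add_coe]; exact le_top
  · obtain ⟨v, hv⟩ := aux_real hf hx
    rw [hv]
    have := aux_young hf hfa hv (h x)
    have : 0 ≤ v + (auxphi f (h x) - h x * r x) := by linarith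
    exact_mod_cast this

/-- The good set of densities. -/
def auxX (f : ℝ → EReal) (Ω : Type*) [MeasurableSpace Ω] : Set (Ω → ℝ) :=
  {r | Measurable r ∧ ∃ B : ℝ, ∀ x, r x ≤ B ∧ ∃ v : ℝ, f (r x) = v ∧ v ≤ B}

theorem auxX_convex (hf : IsF1 a b f) : Convex ℝ (auxX f Ω) := by
  rintro r ⟨hr, B, hB⟩ s ⟨hs, B', hB'⟩ p q hp hq hpq
  refine ⟨(hr.const_smul p).add (hs.const_smul q), p * B + q * B', fun x => ?_⟩
  obtain ⟨h1, v, hv, hvB⟩ := hB x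
  obtain ⟨h2, w, hw, hwB⟩ := hB' x
  obtain ⟨u, hu, hle⟩ := aux_conv hf hv hw hp (by linarith)
  have hq' : q = 1 - p := by linarith
  subst hq'
  simp only [Pi.add_apply, Pi.smul_apply, smul_eq_mul]
  refine ⟨by nlinarith, u, hu, by nlinarith⟩

theorem auxX_r (hf : IsF1 a b f) (hfa : AdmissibleF f) {r : Ω → ℝ} (hr : r ∈ auxX f Ω) :
    r ∈ Mb Ω ∧ (∀ x, 0 ≤ r x) ∧ (fun x => (f (r x)).toReal) ∈ Mb Ω := by
  obtain ⟨hr, B, hB⟩ := hr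
  have h0 : ∀ x, 0 ≤ r x := fun x => by
    obtain ⟨h1, v, hv, hvB⟩ := hB x
    exact aux_neg hf hfa hv
  refine ⟨⟨hr, B, fun x => ?_⟩, h0, ⟨(hf.lsc.measurable.comp hr).ereal_toReal,
    |B| + |auxphi f 0|, fun x => ?_⟩⟩
  · rw [abs_of_nonneg (h0 x)]; exact (hB x).1
  · obtain ⟨h1, v, hv, hvB⟩ := hB x
    have := aux_young hf hfa hv 0
    simp only [hv, EReal.toReal_coe]
    rw [abs_le]
    constructor <;> linarith [le_abs_self B, neg_abs_le B, le_abs_self (auxphi f 0),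
      neg_abs_le (auxphi f 0), abs_nonneg B, abs_nonneg (auxphi f 0)]

/-- Lagrangian. -/
noncomputable def auxL (f : ℝ → EReal) (Q P : Measure Ω) (h r : Ω → ℝ) : ℝ :=
  ∫ x, h x ∂Q + (∫ x, (f (r x)).toReal ∂P - ∫ x, h x * r x ∂P)

theorem auxL_convex (hf : IsF1 a b f) (hfa : AdmissibleF f) (Q P : Measure Ω)
    [IsProbabilityMeasure P] {h : Ω → ℝ} (hh : h ∈ Mb Ω) :
    ConvexOn ℝ (auxX f Ω) (auxL f Q P h) := by
  refine ⟨auxX_convex hf, fun r hr s hs p q hp hq hpq => ?_⟩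
  have hm := auxX_convex hf hr hs hp hq hpq
  obtain ⟨hrb, hr0, hrF⟩ := auxX_r hf hfa hr
  obtain ⟨hsb, hs0, hsF⟩ := auxX_r hf hfa hs
  obtain ⟨hmb, hm0, hmF⟩ := auxX_r hf hfa hm
  have i1 := aux_Mb_mul_int hh (aux_Mb_int hrb P)
  have i2 := aux_Mb_mul_int hh (aux_Mb_int hsb P)
  have e1 : ∫ x, h x * (p • r + q • s) x ∂P = p * ∫ x, h x * r x ∂P + q * ∫ x, h x * s x ∂P := by
    rw [← integral_const_mul, ← integral_const_mul,
      ← integral_add (i1.const_mul p) (i2.const_mul q)]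
    refine integral_congr_ae (ae_of_all _ fun x => ?_)
    simp only [Pi.add_apply, Pi.smul_apply, smul_eq_mul]; ring
  have e2 : ∫ x, (f ((p • r + q • s) x)).toReal ∂P
      ≤ p * ∫ x, (f (r x)).toReal ∂P + q * ∫ x, (f (s x)).toReal ∂P := by
    rw [← integral_const_mul, ← integral_const_mul,
      ← integral_add ((aux_Mb_int hrF P).const_mul p) ((aux_Mb_int hsF P).const_mul q)]
    refine integral_mono (aux_Mb_int hmF P)
      (((aux_Mb_int hrF P).const_mul p).add ((aux_Mb_int hsF P).const_mul q)) fun x => ?_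
    obtain ⟨_, v, hv, -⟩ := hr.2.choose_spec x
    obtain ⟨_, w, hw, -⟩ := hs.2.choose_spec x
    obtain ⟨u, hu, hle⟩ := aux_conv hf hv hw hp (by linarith)
    have hq' : q = 1 - p := by linarith
    subst hq'
    simp only [Pi.add_apply, Pi.smul_apply, smul_eq_mul]
    rw [hu, hv, hw]
    simpa using hle
  simp only [auxL, smul_eq_mul]
  rw [e1]
  have : ∫ x, h x ∂Q = p * ∫ x, h x ∂Q + q * ∫ x, h x ∂Q := by rw [← add_mul, hpq, one_mul]
  simp only [mul_add, mul_sub]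
  linarith

theorem aux_Mb_sum {ι : Type*} [Fintype ι] (w : ι → ℝ) (h : ι → Ω → ℝ) (hh : ∀ i, h i ∈ Mb Ω) :
    (∑ i, w i • h i) ∈ Mb Ω := by
  choose C hC using fun i => (hh i).2
  have hs : (∑ i, w i • h i) = fun x => ∑ i, (w i • h i) x := by ext x; simp
  refine ⟨hs ▸ Finset.measurable_sum _ (fun i _ => (hh i).1.const_smul (w i)), ∑ i, |w i| * C i,
    fun x => ?_⟩
  rw [Finset.sum_apply]
  refine (Finset.abs_sum_le_sum_abs _ _).trans (Finset.sum_le_sum fun i _ => ?_)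
  simp only [Pi.smul_apply, smul_eq_mul, abs_mul]
  exact mul_le_mul_of_nonneg_left (hC i x) (abs_nonneg _)

theorem auxL_sum (hf : IsF1 a b f) (hfa : AdmissibleF f) (Q P : Measure Ω)
    [IsProbabilityMeasure P] [IsProbabilityMeasure Q]
    {ι : Type*} [Fintype ι] (w : ι → ℝ) (hw : ∑ i, w i = 1) (h : ι → Ω → ℝ)
    (hh : ∀ i, h i ∈ Mb Ω) {r : Ω → ℝ} (hr : r ∈ auxX f Ω) :
    ∑ i, w i * auxL f Q P (h i) r = auxL f Q P (∑ i, w i • h i) r := by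
  obtain ⟨hrb, hr0, hrF⟩ := auxX_r hf hfa hr
  simp only [auxL, mul_add, mul_sub, Finset.sum_add_distrib, Finset.sum_sub_distrib]
  rw [← Finset.sum_mul, hw, one_mul]
  congr 2
  · simp only [Finset.sum_apply, Pi.smul_apply, smul_eq_mul]
    rw [integral_finsetSum _ (fun i _ => (aux_Mb_int (hh i) Q).const_mul (w i))]
    simp only [integral_const_mul]
  · simp only [Finset.sum_apply, Pi.smul_apply, smul_eq_mul, Finset.sum_mul, mul_assoc]
    rw [integral_finsetSum _ (fun i _ =>
      (aux_Mb_mul_int (hh i) (aux_Mb_int hrb P)).const_mul (w i))]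
    simp only [integral_const_mul]

theorem auxL_near (hf : IsF1 a b f) (hfa : AdmissibleF f) (Q P : Measure Ω)
    [IsProbabilityMeasure P] {h : Ω → ℝ} (hh : h ∈ Mb Ω) (δ : ℝ) (hδ : 0 < δ) :
    ∃ r ∈ auxX f Ω, auxL f Q P h r ≤ ∫ x, h x ∂Q - ∫ x, auxphi f (h x) ∂P + δ := by
  obtain ⟨ρ, hρm, hρ⟩ := aux_select hf hfa δ hδ
  obtain ⟨C, hC⟩ := hh.2
  obtain ⟨B, hB⟩ := aux_phi_bdd hf hfa (C + 1)
  have hX : (fun x => ρ (h x)) ∈ auxX f Ω := by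
    refine ⟨hρm.comp hh.1, max (B + B + δ) ((B + B + δ) * C + B + δ), fun x => ?_⟩
    obtain ⟨v, hv, hlt⟩ := hρ (h x)
    have h1 := aux_young hf hfa hv (h x + 1)
    have h2 := abs_le.1 (hB (h x) (by linarith [hC x]))
    have h3 := abs_le.1 (hB (h x + 1) ((abs_add_le _ _).trans (by simpa using hC x)))
    have h4 : ρ (h x) ≤ B + B + δ := by linarith
    have h5 := aux_neg hf hfa hv
    have h6 := abs_le.1 (hC x)
    have hC0 : 0 ≤ C := (abs_nonneg _).trans (hC x)
    refine ⟨h4.trans (le_max_left _ _), v, hv, le_trans ?_ (le_max_right _ _)⟩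
    have h7 : ρ (h x) * h x ≤ (B + B + δ) * C :=
      (mul_le_mul_of_nonneg_left h6.2 h5).trans (mul_le_mul_of_nonneg_right h4 hC0)
    linarith
  refine ⟨_, hX, ?_⟩
  obtain ⟨hrb, hr0, hrF⟩ := auxX_r hf hfa hX
  have hpi := aux_Mb_int (aux_phi_Mb hf hfa hh) P
  have him := aux_Mb_mul_int hh (aux_Mb_int hrb P)
  have : ∫ x, (f (ρ (h x))).toReal ∂P ≤ ∫ x, (h x * ρ (h x) - auxphi f (h x) + δ) ∂P := by
    refine integral_mono (aux_Mb_int hrF P) ((him.sub hpi).add (integrable_const δ)) fun x => ?_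
    obtain ⟨v, hv, hlt⟩ := hρ (h x)
    simp only [hv, EReal.toReal_coe]
    linarith
  have e : ∫ x, (h x * ρ (h x) - auxphi f (h x) + δ) ∂P
    = ∫ x, h x * ρ (h x) ∂P - ∫ x, auxphi f (h x) ∂P + δ := by
    have i3 : Integrable (fun x => h x * ρ (h x) - auxphi f (h x)) P := him.sub hpi
    rw [integral_add i3 (integrable_const δ), integral_sub him hpi]
    simp
  rw [e] at this
  simp only [auxL]
  linarith

theorem auxL_K (hf : IsF1 a b f) (hfa : AdmissibleF f) (Q P : Measure Ω)
    [IsProbabilityMeasure P] {h r : Ω → ℝ} (hh : h ∈ Mb Ω) (hr : r ∈ auxX f Ω) :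
    ∫⁻ x, auxK f (h x) (r x) ∂P
      = ENNReal.ofReal (auxL f Q P h r - (∫ x, h x ∂Q - ∫ x, auxphi f (h x) ∂P)) := by
  obtain ⟨hrb, hr0, hrF⟩ := auxX_r hf hfa hr
  have hpi := aux_Mb_int (aux_phi_Mb hf hfa hh) P
  have him := aux_Mb_mul_int hh (aux_Mb_int hrb P)
  have hFi := aux_Mb_int hrF P
  have hsub : Integrable (fun x => auxphi f (h x) - h x * r x) P := hpi.sub him
  have e : auxL f Q P h r - (∫ x, h x ∂Q - ∫ x, auxphi f (h x) ∂P)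
      = ∫ x, ((f (r x)).toReal + (auxphi f (h x) - h x * r x)) ∂P := by
    rw [integral_add hFi hsub, integral_sub hpi him, auxL]; ring
  obtain ⟨_, B, hB⟩ := hr
  have hadd : Integrable (fun x => (f (r x)).toReal + (auxphi f (h x) - h x * r x)) P :=
    hFi.add hsub
  rw [e, ofReal_integral_eq_lintegral_ofReal hadd]
  · refine lintegral_congr fun x => ?_
    obtain ⟨_, v, hv, -⟩ := hB x
    rw [aux_K_coe hf hv]; simp [hv]
  · refine ae_of_all _ fun x => ?_
    obtain ⟨_, v, hv, -⟩ := hB x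
    have := aux_young hf hfa hv (h x)
    simp only [Pi.zero_apply, Pi.add_apply, hv, EReal.toReal_coe]
    linarith

theorem aux_strong (hf : IsF1 a b f) (hfa : AdmissibleF f) (Q P : Measure Ω)
    [IsProbabilityMeasure P] [IsProbabilityMeasure Q]
    (H : Set (Ω → ℝ)) (hHc : Convex ℝ H) (hHb : H ⊆ Mb Ω) (hHne : H.Nonempty) (d : ℝ)
    (hd : ∀ h ∈ H, ∫ x, h x ∂Q - ∫ x, auxphi f (h x) ∂P ≤ d) :
    ∃ r : Ω → ℝ, Measurable r ∧ (∀ x, 0 ≤ r x) ∧ ∀ h ∈ H, ∫⁻ x, auxK f (h x) (r x) ∂P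
      ≤ ENNReal.ofReal (d - (∫ x, h x ∂Q - ∫ x, auxphi f (h x) ∂P)) := by
  let c : (Ω → ℝ) → ℝ := fun h => ∫ x, h x ∂Q - ∫ x, auxphi f (h x) ∂P
  let C : Finset H × ℕ → Set (Ω → ℝ) := fun i =>
    {r | Measurable r ∧ (∀ x, 0 ≤ r x) ∧ ∀ h ∈ i.1, ∫⁻ x, auxK f (h.1 x) (r x) ∂P
      ≤ ENNReal.ofReal (d - c h.1 + 1 / ((i.2 : ℝ) + 1))}
  obtain ⟨h0, hh0⟩ := hHne
  have hh0b := hHb hh0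
  suffices hcomp : ∃ r, ∀ i, r ∈ C i by
    obtain ⟨r, hr⟩ := hcomp
    refine ⟨r, (hr ({⟨h0, hh0⟩}, 0)).1, (hr ({⟨h0, hh0⟩}, 0)).2.1, fun h hh => ?_⟩
    have ht : Tendsto (fun n : ℕ => ENNReal.ofReal (d - c h + 1 / ((n : ℝ) + 1))) atTop
        (𝓝 (ENNReal.ofReal (d - c h + 0))) :=
      (ENNReal.continuous_ofReal.tendsto _).comp
        (tendsto_one_div_add_atTop_nhds_zero_nat.const_add _)
    rw [add_zero] at ht
    exact ge_of_tendsto' ht fun n => (hr ({⟨h, hh⟩}, n)).2.2 ⟨h, hh⟩ (by simp)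
  refine aux_compact P C ?_ ?_ ?_ ?_ ?_ ({⟨h0, hh0⟩}, 0)
      (ENNReal.ofReal (d - c h0 + 1)
        + ∫⁻ x, ENNReal.ofReal (|auxphi f (h0 x + 1) - auxphi f (h0 x)|) ∂P) ?_ ?_
  · rintro ⟨F, n⟩ ⟨G, m⟩ ⟨h1, h2⟩ r ⟨hr1, hr2, hr3⟩
    refine ⟨hr1, hr2, fun h hh => (hr3 h (h1 hh)).trans (ENNReal.ofReal_le_ofReal ?_)⟩
    have : (n : ℝ) ≤ m := by exact_mod_cast h2
    simp only
    gcongr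
  · rintro ⟨F, n⟩
    have hε : (0:ℝ) < 1 / ((n : ℝ) + 1) := by positivity
    obtain ⟨r, hr, hrL⟩ := aux_minimax_fin (ι := F) (auxX f Ω) (fun h => auxL f Q P h.1.1)
      (fun h => auxL_convex hf hfa Q P (hHb h.1.2))
      ⟨fun _ => 1, measurable_const, 1, fun x => ⟨le_rfl, 0, by simpa using hf.at_one, by simp⟩⟩
      (auxX_convex hf) (d + 1 / ((n : ℝ) + 1)) (by
        intro w hw hw1
        have hb := aux_Mb_sum w (fun h : F => h.1.1) (fun h => hHb h.1.2)
        have hH : (∑ h : F, w h • h.1.1) ∈ H :=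
          hHc.sum_mem (fun i _ => hw i) hw1 (fun i _ => i.1.2)
        obtain ⟨r, hr, hle⟩ := auxL_near hf hfa Q P hb _ (half_pos hε)
        refine ⟨r, hr, ?_⟩
        rw [auxL_sum hf hfa Q P w hw1 _ (fun h : F => hHb h.1.2) hr]
        have := hd _ hH
        linarith)
    obtain ⟨hrb, hr0, hrF⟩ := auxX_r hf hfa hr
    refine ⟨r, hr.1, hr0, fun h hh => ?_⟩
    rw [auxL_K hf hfa Q P (hHb h.2) hr]
    refine ENNReal.ofReal_le_ofReal ?_
    have := hrL ⟨h, hh⟩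
    simp only [c] at this ⊢
    linarith
  · rintro i r ⟨h1, h2, h3⟩
    exact ⟨h1, h2⟩
  · rintro i r ⟨h1, h2, h3⟩ s ⟨k1, k2, k3⟩
    refine ⟨(h1.add k1).div_const 2, fun x => by have := h2 x; have := k2 x; positivity, fun h hh => ?_⟩
    have hm1 := aux_K_meas hf hfa (hHb h.2).1 h1
    have hm2 := aux_K_meas hf hfa (hHb h.2).1 k1
    calc ∫⁻ x, auxK f (h.1 x) ((r x + s x) / 2) ∂P
        ≤ ∫⁻ x, (auxK f (h.1 x) (r x) + auxK f (h.1 x) (s x)) * 2⁻¹ ∂P :=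
          lintegral_mono fun x => by
            simpa only [div_eq_mul_inv] using aux_K_mid hf hfa (h.1 x) (r x) (s x)
      _ = (∫⁻ x, auxK f (h.1 x) (r x) ∂P + ∫⁻ x, auxK f (h.1 x) (s x) ∂P) * 2⁻¹ := by
          have hm3 : Measurable (fun x => auxK f (h.1 x) (r x) + auxK f (h.1 x) (s x)) :=
            hm1.add hm2
          rw [lintegral_mul_const _ hm3, lintegral_add_left hm1]
      _ ≤ (ENNReal.ofReal (d - c h.1 + 1 / ((i.2 : ℝ) + 1))
            + ENNReal.ofReal (d - c h.1 + 1 / ((i.2 : ℝ) + 1))) * 2⁻¹ := by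
          gcongr
          · exact h3 h hh
          · exact k3 h hh
      _ = _ := by
          rw [← two_mul, mul_comm, ← mul_assoc, ENNReal.inv_mul_cancel (by simp) (by simp), one_mul]
  · intro i r hr s hs hs0 hlim
    refine ⟨hs, hs0, fun h hh => ?_⟩
    calc ∫⁻ x, auxK f (h.1 x) (s x) ∂P
        ≤ ∫⁻ x, liminf (fun n => auxK f (h.1 x) (r n x)) atTop ∂P := by
          refine lintegral_mono_ae ?_
          filter_upwards [hlim] with x hx
          refine ((aux_K_lsc hf (h.1 x)).le_liminf (s x)).trans ?_
          exact liminf_le_liminf_of_le hx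
      _ ≤ liminf (fun n => ∫⁻ x, auxK f (h.1 x) (r n x) ∂P) atTop :=
          lintegral_liminf_le fun n => aux_K_meas hf hfa (hHb h.2).1 (hr n).1
      _ ≤ _ := liminf_le_of_le (by isBoundedDefault) (fun b hb => by
          obtain ⟨n, hn⟩ := hb.exists
          exact hn.trans ((hr n).2.2 h hh))
  · refine ENNReal.add_ne_top.2 ⟨ENNReal.ofReal_ne_top, ?_⟩
    have h1 : (fun x => h0 x + 1) ∈ Mb Ω := by
      obtain ⟨B, hB⟩ := hh0b.2
      exact ⟨hh0b.1.add_const 1, B + 1, fun x => (abs_add_le _ _).trans (by simpa using hB x)⟩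
    exact (((aux_Mb_int (aux_phi_Mb hf hfa h1) P).sub
      (aux_Mb_int (aux_phi_Mb hf hfa hh0b) P)).abs).lintegral_lt_top.ne
  · rintro r ⟨h1, h2, h3⟩
    have := h3 ⟨h0, hh0⟩ (by simp)
    calc ∫⁻ x, ENNReal.ofReal (r x) ∂P
        ≤ ∫⁻ x, (auxK f (h0 x) (r x)
            + ENNReal.ofReal (|auxphi f (h0 x + 1) - auxphi f (h0 x)|)) ∂P :=
          lintegral_mono fun x => aux_K_bound hf hfa _ _
      _ = ∫⁻ x, auxK f (h0 x) (r x) ∂P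
            + ∫⁻ x, ENNReal.ofReal (|auxphi f (h0 x + 1) - auxphi f (h0 x)|) ∂P :=
          lintegral_add_left (aux_K_meas hf hfa hh0b.1 h1) _
      _ ≤ _ := by
          gcongr
          simpa using this

end main

section fin
variable {a b : EReal} {f : ℝ → EReal} {Ω : Type*} [MeasurableSpace Ω]

theorem aux_dens (η P : Measure Ω) [IsProbabilityMeasure η] [IsProbabilityMeasure P]
    (hac : η ≪ P) (h : Ω → ℝ) :
    ∫ x, h x * (η.rnDeriv P x).toReal ∂P = ∫ x, h x ∂η := by
  rw [← integral_rnDeriv_smul hac]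
  simp only [smul_eq_mul, mul_comm]

theorem aux_dens_m (η P : Measure Ω) : Measurable (fun x => (η.rnDeriv P x).toReal) :=
  (Measure.measurable_rnDeriv _ _).ennreal_toReal

theorem aux_fDiv_Phi (hf : IsF1 a b f) (hfa : AdmissibleF f) (η P : Measure Ω)
    [IsProbabilityMeasure η] [IsProbabilityMeasure P] (hac : η ≪ P) {h : Ω → ℝ} (hh : h ∈ Mb Ω) :
    fDivE f η P + ((∫ x, auxphi f (h x) ∂P - ∫ x, h x ∂η : ℝ) : EReal)
      = ((∫⁻ x, auxK f (h x) (η.rnDeriv P x).toReal ∂P : ℝ≥0∞) : EReal) := by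
  have hi : Integrable (fun x => (η.rnDeriv P x).toReal) P := Measure.integrable_toReal_rnDeriv
  rw [fDivE, if_pos hac, ← aux_Phi hf hfa P hh (aux_dens_m η P) hi,
    integral_sub (aux_Mb_int (aux_phi_Mb hf hfa hh) P) (aux_Mb_mul_int hh hi),
    aux_dens η P hac h]

theorem aux_fDiv_nonneg (hf : IsF1 a b f) (η P : Measure Ω)
    [IsProbabilityMeasure η] [IsProbabilityMeasure P] : 0 ≤ fDivE f η P := by
  by_cases hac : η ≪ P
  · obtain ⟨c, hc⟩ := aux_subgrad hf
    have hi : Integrable (fun x => (η.rnDeriv P x).toReal) P := Measure.integrable_toReal_rnDeriv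
    have h1 : ∫ x, (η.rnDeriv P x).toReal ∂P = 1 := by
      have := aux_dens η P hac (fun _ => 1)
      simpa using this
    have hi2 : Integrable (fun x => -c * ((η.rnDeriv P x).toReal - 1)) P :=
      (hi.sub (integrable_const 1)).const_mul (-c)
    have key := aux_eInt P (fun x => f (η.rnDeriv P x).toReal)
      (fun x => -c * ((η.rnDeriv P x).toReal - 1)) (hf.lsc.measurable.comp (aux_dens_m η P)) hi2
      (fun x => by
        by_cases hx : f (η.rnDeriv P x).toReal = ⊤
        · rw [hx, EReal.top_add_coe]; exact le_top
        · obtain ⟨v, hv⟩ := aux_real hf hx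
          rw [hv]
          have := hc _ _ hv
          have : 0 ≤ v + -c * ((η.rnDeriv P x).toReal - 1) := by linarith
          exact_mod_cast this)
    have h0 : ∫ x, -c * ((η.rnDeriv P x).toReal - 1) ∂P = 0 := by
      rw [integral_const_mul, integral_sub hi (integrable_const 1), h1]; simp
    rw [h0, EReal.coe_zero, add_zero] at key
    rw [fDivE, if_pos hac, key]
    exact EReal.coe_ennreal_nonneg _
  · rw [fDivE, if_neg hac]; exact le_top

theorem aux_ipm_nonneg {Γ : Set (Ω → ℝ)} (h0 : (fun _ => (0:ℝ)) ∈ Γ) (Q η : Measure Ω) :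
    0 ≤ ipmW Γ Q η := by
  refine le_trans ?_ (le_iSup₂ (f := fun g (_ : g ∈ Γ) =>
    (((∫ x, g x ∂Q : ℝ) : EReal) - ((∫ x, g x ∂η : ℝ) : EReal))) _ h0)
  simp

theorem aux_Mb_sub {g : Ω → ℝ} (hg : g ∈ Mb Ω) (ν : ℝ) : (fun x => g x - ν) ∈ Mb Ω := by
  obtain ⟨B, hB⟩ := hg.2
  exact ⟨hg.1.sub_const ν, B + |ν|, fun x => (abs_sub _ _).trans (by linarith [hB x])⟩

theorem aux_Lam (hf : IsF1 a b f) (hfa : AdmissibleF f) (P : Measure Ω)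
    [IsProbabilityMeasure P] {g : Ω → ℝ} (hg : g ∈ Mb Ω) :
    LambdaF f P g = ⨅ ν : ℝ, ((ν + ∫ x, auxphi f (g x - ν) ∂P : ℝ) : EReal) := by
  refine iInf_congr fun ν => ?_
  have hm := aux_phi_Mb hf hfa (aux_Mb_sub hg ν)
  simp only [aux_phi_coe hf hfa]
  rw [aux_eInt_real P _ hm.1 (aux_Mb_int hm P), EReal.coe_add]

theorem aux_int_sub {g : Ω → ℝ} (hg : g ∈ Mb Ω) (ν : ℝ) (Q : Measure Ω) [IsProbabilityMeasure Q] :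
    ∫ x, (g x - ν) ∂Q = ∫ x, g x ∂Q - ν := by
  rw [integral_sub (aux_Mb_int hg Q) (integrable_const ν)]; simp

theorem aux_weak (hf : IsF1 a b f) (hfa : AdmissibleF f) {Γ : Set (Ω → ℝ)}
    (h0 : (fun _ => (0:ℝ)) ∈ Γ) (hΓ : Γ ⊆ Mb Ω) (Q P η : Measure Ω)
    [IsProbabilityMeasure Q] [IsProbabilityMeasure η] [IsProbabilityMeasure P] :
    fGammaDiv f Γ Q P ≤ fDivE f η P + ipmW Γ Q η := by
  have hn := aux_fDiv_nonneg hf η P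
  have hw := aux_ipm_nonneg h0 Q η
  by_cases ht : fDivE f η P = ⊤
  · rw [ht, EReal.top_add_of_ne_bot (ne_of_gt (lt_of_lt_of_le EReal.bot_lt_zero hw))]
    exact le_top
  have hac : η ≪ P := by
    by_contra hac
    exact ht (by rw [fDivE, if_neg hac])
  have hPhi := fun h (hh : h ∈ Mb Ω) => aux_fDiv_Phi hf hfa η P hac hh
  induction he : fDivE f η P with
  | top => exact absurd he ht
  | bot => rw [he] at hn; simp at hn
  | coe e =>
  rw [he] at hPhi
  refine iSup₂_le fun g hg => ?_
  have hgb := hΓ hg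
  have hL : ((∫ x, g x ∂η - e : ℝ) : EReal) ≤ LambdaF f P g := by
    rw [aux_Lam hf hfa P hgb]
    refine le_iInf fun ν => ?_
    have h1 := hPhi _ (aux_Mb_sub hgb ν)
    have h2 : (0 : EReal) ≤ ((e + (∫ x, auxphi f (g x - ν) ∂P - ∫ x, (g x - ν) ∂η) : ℝ) : EReal) := by
      rw [EReal.coe_add, h1]; exact EReal.coe_ennreal_nonneg _
    rw [aux_int_sub hgb] at h2
    have h3 : 0 ≤ e + (∫ x, auxphi f (g x - ν) ∂P - (∫ x, g x ∂η - ν)) := by exact_mod_cast h2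
    exact_mod_cast (by linarith)
  calc ((∫ x, g x ∂Q : ℝ) : EReal) - LambdaF f P g
      ≤ ((∫ x, g x ∂Q : ℝ) : EReal) - ((∫ x, g x ∂η - e : ℝ) : EReal) :=
        EReal.sub_le_sub le_rfl hL
    _ = (e : EReal) + (((∫ x, g x ∂Q : ℝ) : EReal) - ((∫ x, g x ∂η : ℝ) : EReal)) := by
        norm_cast; ring
    _ ≤ (e : EReal) + ipmW Γ Q η := by
        gcongr
        exact le_iSup₂ (f := fun g (_ : g ∈ Γ) =>
          (((∫ x, g x ∂Q : ℝ) : EReal) - ((∫ x, g x ∂η : ℝ) : EReal))) g hg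

theorem aux_eInt_congr (P : Measure Ω) {h k : Ω → EReal} (hk : h =ᵐ[P] k) :
    eIntegral P h = eIntegral P k := by
  have e1 : ∫⁻ x, posE (h x) ∂P = ∫⁻ x, posE (k x) ∂P :=
    lintegral_congr_ae (by filter_upwards [hk] with x hx; rw [hx])
  have e2 : ∫⁻ x, posE (-(h x)) ∂P = ∫⁻ x, posE (-(k x)) ∂P :=
    lintegral_congr_ae (by filter_upwards [hk] with x hx; rw [hx])
  rw [eIntegral, eIntegral, e1, e2]

theorem aux_wd (hf : IsF1 a b f) (P : Measure Ω) [IsProbabilityMeasure P] {r : Ω → ℝ}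
    (hrm : Measurable r) (hr0 : ∀ x, 0 ≤ r x) (hri : Integrable r P) (hr1 : ∫ x, r x ∂P = 1) :
    ∃ η : Measure Ω, IsProbabilityMeasure η ∧ fDivE f η P = eIntegral P (fun x => f (r x)) ∧
      ∀ h : Ω → ℝ, ∫ x, h x ∂η = ∫ x, h x * r x ∂P := by
  have hm : Measurable (fun x => ENNReal.ofReal (r x)) := hrm.ennreal_ofReal
  have hac : P.withDensity (fun x => ENNReal.ofReal (r x)) ≪ P := withDensity_absolutelyContinuous _ _
  have hrn := Measure.rnDeriv_withDensity P hm
  refine ⟨P.withDensity (fun x => ENNReal.ofReal (r x)), ⟨?_⟩, ?_, fun h => ?_⟩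
  · rw [withDensity_apply _ MeasurableSet.univ, Measure.restrict_univ,
      ← ofReal_integral_eq_lintegral_ofReal hri (ae_of_all _ hr0), hr1, ENNReal.ofReal_one]
  · rw [fDivE, if_pos hac]
    have hae : ∀ᵐ x ∂P, ((P.withDensity (fun x => ENNReal.ofReal (r x))).rnDeriv P x).toReal = r x := by
      filter_upwards [hrn] with x hx
      rw [hx, ENNReal.toReal_ofReal (hr0 x)]
    refine aux_eInt_congr P ?_
    filter_upwards [hae] with x hx
    rw [hx]
  · rw [integral_withDensity_eq_integral_toReal_smul hm (ae_of_all _ fun x => ENNReal.ofReal_lt_top)]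
    refine integral_congr_ae (ae_of_all _ fun x => ?_)
    simp only [smul_eq_mul, ENNReal.toReal_ofReal (hr0 x), mul_comm]

theorem aux_coe_of (E : EReal) (u : ℝ) (k : ℝ≥0∞) (hk : k ≠ ⊤) (h : E + (u : EReal) = (k : EReal)) :
    ∃ e : ℝ, E = e ∧ e + u = k.toReal := by
  lift k to NNReal using hk
  have h' : E + (u : EReal) = ((k : ℝ) : EReal) := h
  induction E with
  | top => rw [EReal.top_add_coe] at h'; exact absurd h'.symm (EReal.coe_ne_top _)
  | bot => rw [EReal.bot_add] at h'; exact absurd h'.symm (EReal.coe_ne_bot _)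
  | coe e => exact ⟨e, rfl, by exact_mod_cast h'⟩

theorem aux_attain (hf : IsF1 a b f) (hfa : AdmissibleF f) {Γ : Set (Ω → ℝ)}
    (h0 : (fun _ => (0:ℝ)) ∈ Γ) (hΓc : Convex ℝ Γ) (hΓ : Γ ⊆ Mb Ω) (Q P : Measure Ω)
    [IsProbabilityMeasure Q] [IsProbabilityMeasure P] (hD : fGammaDiv f Γ Q P < ⊤) :
    ∃ η : Measure Ω, IsProbabilityMeasure η ∧ fDivE f η P + ipmW Γ Q η ≤ fGammaDiv f Γ Q P := by
  have hlow : ∀ g ∈ Γ, ∀ ν : ℝ, ((∫ x, g x ∂Q - (ν + ∫ x, auxphi f (g x - ν) ∂P) : ℝ) : EReal)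
      ≤ fGammaDiv f Γ Q P := by
    intro g hg ν
    refine le_trans ?_ (le_iSup₂ (f := fun g (_ : g ∈ Γ) =>
      (((∫ x, g x ∂Q : ℝ) : EReal) - LambdaF f P g)) g hg)
    rw [EReal.coe_sub]
    refine EReal.sub_le_sub le_rfl ?_
    rw [aux_Lam hf hfa P (hΓ hg)]
    exact iInf_le _ ν
  induction hd : fGammaDiv f Γ Q P with
  | top => rw [hd] at hD; simp at hD
  | bot => 
    have := hlow _ h0 0
    rw [hd] at this
    exact absurd (le_bot_iff.1 this) (EReal.coe_ne_bot _)
  | coe d =>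
  rw [hd] at hlow
  let H : Set (Ω → ℝ) := {h | ∃ g ∈ Γ, ∃ ν : ℝ, h = fun x => g x - ν}
  have hHb : H ⊆ Mb Ω := by
    rintro h ⟨g, hg, ν, rfl⟩
    exact aux_Mb_sub (hΓ hg) ν
  have hHc : Convex ℝ H := by
    rintro _ ⟨g, hg, ν, rfl⟩ _ ⟨g', hg', ν', rfl⟩ p q hp hq hpq
    refine ⟨_, hΓc hg hg' hp hq hpq, p * ν + q * ν', ?_⟩
    ext x
    simp only [Pi.add_apply, Pi.smul_apply, smul_eq_mul]; ring
  have hH0 : (fun _ => (0:ℝ)) ∈ H := ⟨_, h0, 0, by ext; simp⟩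
  have hHd : ∀ h ∈ H, ∫ x, h x ∂Q - ∫ x, auxphi f (h x) ∂P ≤ d := by
    rintro _ ⟨g, hg, ν, rfl⟩
    have := hlow g hg ν
    rw [aux_int_sub (hΓ hg)]
    have h2 : ∫ x, g x ∂Q - (ν + ∫ x, auxphi f (g x - ν) ∂P) ≤ d := by exact_mod_cast this
    linarith
  obtain ⟨r, hrm, hr0, hrK⟩ := aux_strong hf hfa Q P H hHc hHb ⟨_, hH0⟩ d hHd
  have hri : Integrable r P := by
    refine ⟨hrm.aestronglyMeasurable, ?_⟩
    rw [hasFiniteIntegral_iff_ofReal (ae_of_all _ hr0)]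
    have hK := hrK _ hH0
    calc ∫⁻ x, ENNReal.ofReal (r x) ∂P
        ≤ ∫⁻ x, (auxK f 0 (r x) + ENNReal.ofReal (|auxphi f (0 + 1) - auxphi f 0|)) ∂P :=
          lintegral_mono fun x => aux_K_bound hf hfa _ _
      _ = ∫⁻ x, auxK f 0 (r x) ∂P + ENNReal.ofReal (|auxphi f (0 + 1) - auxphi f 0|) := by
          rw [lintegral_add_right _ measurable_const]; simp
      _ < ⊤ := ENNReal.add_lt_top.2 ⟨hK.trans_lt ENNReal.ofReal_lt_top, ENNReal.ofReal_lt_top⟩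
  have hE : ∀ h ∈ H, ∃ e : ℝ, eIntegral P (fun x => f (r x)) = e ∧
      e + ∫ x, h x ∂Q - ∫ x, h x * r x ∂P ≤ d := by
    intro h hh
    have hhb := hHb hh
    have hK := hrK h hh
    obtain ⟨e, he, he2⟩ := aux_coe_of _ _ _ (ne_top_of_le_ne_top ENNReal.ofReal_ne_top hK)
      (aux_Phi hf hfa P hhb hrm hri)
    refine ⟨e, he, ?_⟩
    have h1 := ENNReal.toReal_mono ENNReal.ofReal_ne_top hK
    rw [ENNReal.toReal_ofReal (by linarith [hHd h hh]), ← he2,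
      integral_sub (aux_Mb_int (aux_phi_Mb hf hfa hhb) P) (aux_Mb_mul_int hhb hri)] at h1
    linarith
  obtain ⟨e, he, -⟩ := hE _ hH0
  have hE2 : ∀ g ∈ Γ, ∀ ν : ℝ, e + (∫ x, g x ∂Q - ν) - (∫ x, g x * r x ∂P - ν * ∫ x, r x ∂P) ≤ d := by
    intro g hg ν
    obtain ⟨e', he', h2⟩ := hE _ ⟨g, hg, ν, rfl⟩
    have : e' = e := by rw [he] at he'; exact_mod_cast he'.symm
    subst this
    rw [aux_int_sub (hΓ hg)] at h2
    simp only [sub_mul] at h2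
    rw [integral_sub (aux_Mb_mul_int (hΓ hg) hri) (hri.const_mul ν), integral_const_mul] at h2
    exact h2
  have hr1 : ∫ x, r x ∂P = 1 := by
    by_contra hne
    have hne' : ∫ x, r x ∂P - 1 ≠ 0 := sub_ne_zero.2 hne
    have := hE2 _ h0 ((d - e + 1) / (∫ x, r x ∂P - 1))
    simp only [integral_zero, zero_mul] at this
    have h3 : (d - e + 1) / (∫ x, r x ∂P - 1) * (∫ x, r x ∂P - 1) = d - e + 1 := div_mul_cancel₀ _ hne'
    linarith
  obtain ⟨η, hη, hηd, hηi⟩ := aux_wd hf P hrm hr0 hri hr1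
  refine ⟨η, hη, ?_⟩
  rw [hηd, he]
  have hW : ipmW Γ Q η ≤ ((d - e : ℝ) : EReal) := by
    refine iSup₂_le fun g hg => ?_
    have := hE2 g hg 0
    rw [hηi]
    rw [← EReal.coe_sub]
    exact_mod_cast (by linarith)
  calc (e : EReal) + ipmW Γ Q η ≤ (e : EReal) + ((d - e : ℝ) : EReal) := by gcongr
    _ = d := by rw [← EReal.coe_add]; congr 1; ring

theorem aux_strict (hf : IsF1 a b f) (hs : StrictConvexOnAB a b f) {x y v w : ℝ} (hv : f x = v)
    (hw : f y = w) (hxy : x < y) : ∃ u : ℝ, f ((x + y) / 2) = u ∧ u < (v + w) / 2 := by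
  have hax : a ≤ x := by
    by_contra h
    have := hf.top_outside x (Or.inl (not_le.1 h))
    rw [hv] at this; exact EReal.coe_ne_top _ this
  have hyb : (y : EReal) ≤ b := by
    by_contra h
    have := hf.top_outside y (Or.inr (not_le.1 h))
    rw [hw] at this; exact EReal.coe_ne_top _ this
  obtain ⟨u, hu, hule⟩ := aux_mid hf hv hw
  obtain ⟨p, hp, hple⟩ := aux_mid hf hv hu
  obtain ⟨q, hq, hqle⟩ := aux_mid hf hu hw
  have i1 : ∀ z : ℝ, x < z → a < (z : EReal) := fun z hz =>
    lt_of_le_of_lt hax (by exact_mod_cast hz)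
  have i2 : ∀ z : ℝ, z < y → (z : EReal) < b := fun z hz =>
    lt_of_lt_of_le (by exact_mod_cast hz) hyb
  have key := hs ((x + (x + y) / 2) / 2) (((x + y) / 2 + y) / 2) (1 / 2) (i1 _ (by linarith))
    (i2 _ (by linarith)) (i1 _ (by linarith)) (i2 _ (by linarith)) (by intro h; linarith)
    (by norm_num) (by norm_num)
  have e : (1 / 2 : ℝ) * ((x + (x + y) / 2) / 2) + (1 - 1 / 2) * (((x + y) / 2 + y) / 2)
    = (x + y) / 2 := by ring
  rw [e, hu, hp, hq] at key
  have key2 : u < (1 / 2 : ℝ) * p + (1 - 1 / 2) * q := by exact_mod_cast key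
  exact ⟨u, hu, by linarith⟩

theorem aux_core (hf : IsF1 a b f) (hfa : AdmissibleF f) (hs : StrictConvexOnAB a b f)
    (P : Measure Ω) {r s : Ω → ℝ} (hr : Measurable r) (hsm : Measurable s)
    (hkr : ∫⁻ x, auxK f 0 (r x) ∂P ≠ ⊤) (hks : ∫⁻ x, auxK f 0 (s x) ∂P ≠ ⊤)
    (hmid : (∫⁻ x, auxK f 0 (r x) ∂P + ∫⁻ x, auxK f 0 (s x) ∂P) * 2⁻¹
      ≤ ∫⁻ x, auxK f 0 ((r x + s x) / 2) ∂P) : s =ᵐ[P] r := by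
  have hm1 : Measurable (fun x => auxK f 0 (r x)) := aux_K_meas hf hfa measurable_const hr
  have hm2 : Measurable (fun x => auxK f 0 (s x)) := aux_K_meas hf hfa measurable_const hsm
  have hm3 : Measurable (fun x => auxK f 0 (r x) + auxK f 0 (s x)) := hm1.add hm2
  have hI : ∫⁻ x, (auxK f 0 (r x) + auxK f 0 (s x)) * 2⁻¹ ∂P
      = (∫⁻ x, auxK f 0 (r x) ∂P + ∫⁻ x, auxK f 0 (s x) ∂P) * 2⁻¹ := by
    rw [lintegral_mul_const _ hm3, lintegral_add_left hm1]
  have hle : ∀ x, auxK f 0 ((r x + s x) / 2) ≤ (auxK f 0 (r x) + auxK f 0 (s x)) * 2⁻¹ := fun x => by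
    simpa only [div_eq_mul_inv] using aux_K_mid hf hfa 0 (r x) (s x)
  have hfin : ∫⁻ x, auxK f 0 ((r x + s x) / 2) ∂P ≠ ⊤ := by
    refine ne_top_of_le_ne_top ?_ (lintegral_mono hle)
    rw [hI]
    exact ENNReal.mul_ne_top (ENNReal.add_ne_top.2 ⟨hkr, hks⟩) (by simp)
  have heq := ae_eq_of_ae_le_of_lintegral_le (ae_of_all P hle) hfin
    (hm3.mul_const _).aemeasurable (hI.le.trans hmid)
  filter_upwards [heq, ae_lt_top hm1 hkr, ae_lt_top hm2 hks] with x hx t1 t2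
  have n1 : f (r x) ≠ ⊤ := fun h => t1.ne (aux_K_top h 0)
  have n2 : f (s x) ≠ ⊤ := fun h => t2.ne (aux_K_top h 0)
  obtain ⟨v, hv⟩ := aux_real hf n1
  obtain ⟨w, hw⟩ := aux_real hf n2
  by_contra hne
  have hst : ∃ u : ℝ, f ((r x + s x) / 2) = u ∧ u < (v + w) / 2 := by
    rcases lt_or_gt_of_ne hne with h | h
    · obtain ⟨u, hu, hlt⟩ := aux_strict hf hs hw hv h
      exact ⟨u, by rw [add_comm]; exact hu, by linarith⟩
    · exact aux_strict hf hs hv hw h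
  obtain ⟨u, hu, hlt⟩ := hst
  have y1 := aux_young hf hfa hv 0
  have y2 := aux_young hf hfa hw 0
  have y3 := aux_young hf hfa hu 0
  rw [aux_K_coe hf hv, aux_K_coe hf hw, aux_K_coe hf hu,
    ← ENNReal.ofReal_add (by linarith) (by linarith)] at hx
  have h3 := congrArg ENNReal.toReal hx
  rw [ENNReal.toReal_mul, ENNReal.toReal_ofReal (by linarith),
    ENNReal.toReal_ofReal (by linarith)] at h3
  simp only [ENNReal.toReal_inv, ENNReal.toReal_ofNat] at h3
  linarith

theorem aux_coe_k {u : ℝ} {k : ℝ≥0∞} (h : (u : EReal) = (k : EReal)) : k ≠ ⊤ ∧ u = k.toReal := by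
  have hk : k ≠ ⊤ := by
    rintro rfl
    rw [EReal.coe_ennreal_top] at h
    exact EReal.coe_ne_top _ h
  refine ⟨hk, ?_⟩
  obtain ⟨e, he, he2⟩ := aux_coe_of (u : EReal) 0 k hk (by simpa using h)
  have : u = e := by exact_mod_cast he
  linarith

theorem aux_unique (hf : IsF1 a b f) (hfa : AdmissibleF f) {Γ : Set (Ω → ℝ)}
    (h0 : (fun _ => (0:ℝ)) ∈ Γ) (hΓ : Γ ⊆ Mb Ω) (Q P : Measure Ω)
    [IsProbabilityMeasure Q] [IsProbabilityMeasure P] (hD : fGammaDiv f Γ Q P < ⊤)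
    (hs : StrictConvexOnAB a b f) (η η' : Measure Ω) [IsProbabilityMeasure η]
    [IsProbabilityMeasure η'] (h1 : fGammaDiv f Γ Q P = fDivE f η P + ipmW Γ Q η)
    (h2 : fGammaDiv f Γ Q P = fDivE f η' P + ipmW Γ Q η') : η' = η := by
  have hz : (fun _ => (0:ℝ)) ∈ Mb Ω := hΓ h0
  have main : ∀ η : Measure Ω, IsProbabilityMeasure η →
      fGammaDiv f Γ Q P = fDivE f η P + ipmW Γ Q η → η ≪ P ∧ ∃ e w : ℝ, fDivE f η P = e ∧
        ipmW Γ Q η = w := by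
    intro η hη h
    have hn := aux_fDiv_nonneg hf η P
    have hw := aux_ipm_nonneg h0 Q η
    rw [h] at hD
    have n1 : fDivE f η P ≠ ⊤ := by
      intro ht
      rw [ht, EReal.top_add_of_ne_bot (ne_of_gt (lt_of_lt_of_le EReal.bot_lt_zero hw))] at hD
      exact lt_irrefl _ hD
    have n2 : ipmW Γ Q η ≠ ⊤ := by
      intro ht
      rw [ht, EReal.add_top_of_ne_bot (ne_of_gt (lt_of_lt_of_le EReal.bot_lt_zero hn))] at hD
      exact lt_irrefl _ hD
    refine ⟨?_, (fDivE f η P).toReal, (ipmW Γ Q η).toReal, ?_, ?_⟩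
    · by_contra hac
      exact n1 (by rw [fDivE, if_neg hac])
    · exact (EReal.coe_toReal n1 (ne_of_gt (lt_of_lt_of_le EReal.bot_lt_zero hn))).symm
    · exact (EReal.coe_toReal n2 (ne_of_gt (lt_of_lt_of_le EReal.bot_lt_zero hw))).symm
  obtain ⟨hac, e, w, he, hw⟩ := main η inferInstance h1
  obtain ⟨hac', e', w', he', hw'⟩ := main η' inferInstance h2
  have hK := aux_fDiv_Phi hf hfa η P hac hz
  have hK' := aux_fDiv_Phi hf hfa η' P hac' hz
  have hsum : e + w = e' + w' := by
    rw [h1, he, hw, he', hw'] at h2; exact_mod_cast h2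
  have hri : Integrable (fun x => (η.rnDeriv P x).toReal) P := Measure.integrable_toReal_rnDeriv
  have hri' : Integrable (fun x => (η'.rnDeriv P x).toReal) P := Measure.integrable_toReal_rnDeriv
  have hrd := aux_dens η P hac
  have hrd' := aux_dens η' P hac'
  have hrm := aux_dens_m η P
  have hrm' := aux_dens_m η' P
  have hr0 : ∀ x, 0 ≤ (η.rnDeriv P x).toReal := fun x => ENNReal.toReal_nonneg
  have hr0' : ∀ x, 0 ≤ (η'.rnDeriv P x).toReal := fun x => ENNReal.toReal_nonneg
  have hfin : (fun x => (η'.rnDeriv P x).toReal) =ᵐ[P] (fun x => (η.rnDeriv P x).toReal) → η' = η := by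
    intro h
    rw [← Measure.withDensity_rnDeriv_eq η P hac, ← Measure.withDensity_rnDeriv_eq η' P hac']
    refine withDensity_congr_ae ?_
    filter_upwards [h, Measure.rnDeriv_lt_top η P, Measure.rnDeriv_lt_top η' P] with x hx t1 t2
    exact (ENNReal.toReal_eq_toReal_iff' t2.ne t1.ne).1 hx
  apply hfin
  rw [he, ← EReal.coe_add] at hK
  rw [he', ← EReal.coe_add] at hK'
  obtain ⟨k1, k2⟩ := aux_coe_k hK
  obtain ⟨k1', k2'⟩ := aux_coe_k hK'
  refine aux_core hf hfa hs P hrm hrm' k1 k1' ?_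
  by_cases htop : ∫⁻ x, auxK f 0 (((η.rnDeriv P x).toReal + (η'.rnDeriv P x).toReal) / 2) ∂P = ⊤
  · rw [htop]; exact le_top
  have hmm : Measurable (fun x => ((η.rnDeriv P x).toReal + (η'.rnDeriv P x).toReal) / 2) :=
    (hrm.add hrm').div_const 2
  have hmi : Integrable (fun x => ((η.rnDeriv P x).toReal + (η'.rnDeriv P x).toReal) / 2) P :=
    (hri.add hri').div_const 2
  have hmint : ∀ h ∈ Mb Ω,
      ∫ x, h x * (((η.rnDeriv P x).toReal + (η'.rnDeriv P x).toReal) / 2) ∂P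
        = (∫ x, h x ∂η + ∫ x, h x ∂η') / 2 := by
    intro h hh
    rw [← hrd h, ← hrd' h, ← integral_add (aux_Mb_mul_int hh hri) (aux_Mb_mul_int hh hri'),
      ← integral_div]
    refine integral_congr_ae (ae_of_all _ fun x => ?_)
    simp only
    ring
  have hm1 : ∫ x, ((η.rnDeriv P x).toReal + (η'.rnDeriv P x).toReal) / 2 ∂P = 1 := by
    have := hmint (fun _ => 1) ⟨measurable_const, 1, fun x => by simp⟩
    simp only [one_mul, integral_const, probReal_univ, smul_eq_mul, mul_one] at this
    rw [this]; norm_num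
  obtain ⟨μ, hμ, hμd, hμi⟩ := aux_wd hf P hmm
    (fun x => by have := hr0 x; have := hr0' x; positivity) hmi hm1
  obtain ⟨m, hm, hm2⟩ := aux_coe_of _ _ _ htop (aux_Phi hf hfa P hz hmm hmi)
  have hW : ipmW Γ Q μ ≤ (((w + w') / 2 : ℝ) : EReal) := by
    refine iSup₂_le fun g hg => ?_
    have a1 := le_iSup₂ (f := fun g (_ : g ∈ Γ) =>
      (((∫ x, g x ∂Q : ℝ) : EReal) - ((∫ x, g x ∂η : ℝ) : EReal))) g hg
    have a2 := le_iSup₂ (f := fun g (_ : g ∈ Γ) =>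
      (((∫ x, g x ∂Q : ℝ) : EReal) - ((∫ x, g x ∂η' : ℝ) : EReal))) g hg
    have b1 := a1.trans hw.le
    have b2 := a2.trans hw'.le
    have c1 : ∫ x, g x ∂Q - ∫ x, g x ∂η ≤ w := by exact_mod_cast b1
    have c2 : ∫ x, g x ∂Q - ∫ x, g x ∂η' ≤ w' := by exact_mod_cast b2
    rw [hμi, hmint g (hΓ hg), ← EReal.coe_sub]
    exact EReal.coe_le_coe_iff.2 (by linarith)
  have hwk := aux_weak hf hfa h0 hΓ Q P μ
  rw [h1, hμd, he, hw, hm] at hwk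
  have hwk2 : ((e + w : ℝ) : EReal) ≤ ((m + (w + w') / 2 : ℝ) : EReal) := by
    rw [EReal.coe_add, EReal.coe_add]
    exact hwk.trans (by gcongr)
  have hwk3 : e + w ≤ m + (w + w') / 2 := EReal.coe_le_coe_iff.1 hwk2
  rw [← ENNReal.toReal_le_toReal (ENNReal.mul_ne_top (ENNReal.add_ne_top.2 ⟨k1, k1'⟩) (by simp)) htop,
    ENNReal.toReal_mul, ENNReal.toReal_add k1 k1', ← k2, ← k2', ← hm2]
  simp only [ENNReal.toReal_inv, ENNReal.toReal_ofNat, integral_zero, zero_mul, sub_zero]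
  linarith
end fin

/-- (Infimal convolution formula.) On a complete separable metric space,
for admissible `f` and admissible `Γ ⊆ C_b(S)`:
`D_f^Γ(Q‖P) = inf_η {D_f(η‖P) + W^Γ(Q,η)}`, in particular
`0 ≤ D_f^Γ(Q‖P) ≤ min{D_f(Q‖P), W^Γ(Q,P)}`; if `D_f^Γ(Q‖P) < ∞` the infimum is attained,
uniquely so when `f` is strictly convex on `(a,b)`. -/
theorem stmt10 {S : Type*} [MetricSpace S] [CompleteSpace S]
    [TopologicalSpace.SeparableSpace S] [MeasurableSpace S] [BorelSpace S]
    (a b : EReal) (f : ℝ → EReal) (hf : IsF1 a b f) (hfa : AdmissibleF f)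
    (Γ : Set (S → ℝ)) (hΓ : AdmissibleGamma Γ)
    (Q P : Measure S) [IsProbabilityMeasure Q] [IsProbabilityMeasure P] :
    fGammaDiv f Γ Q P
      = (⨅ η ∈ {η : Measure S | IsProbabilityMeasure η}, (fDivE f η P + ipmW Γ Q η))
    ∧ 0 ≤ fGammaDiv f Γ Q P
    ∧ fGammaDiv f Γ Q P ≤ min (fDivE f Q P) (ipmW Γ Q P)
    ∧ (fGammaDiv f Γ Q P < ⊤ → ∃ ηs : Measure S, IsProbabilityMeasure ηs ∧
        fGammaDiv f Γ Q P = fDivE f ηs P + ipmW Γ Q ηs ∧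
        (StrictConvexOnAB a b f → ∀ η' : Measure S, IsProbabilityMeasure η' →
          fGammaDiv f Γ Q P = fDivE f η' P + ipmW Γ Q η' → η' = ηs)) := by
  obtain ⟨h0, hΓc, hΓb, -⟩ := hΓ
  have hΓM : Γ ⊆ Mb S := fun g hg => ⟨(hΓb hg).1.measurable, (hΓb hg).2⟩
  have hweak : ∀ η : Measure S, IsProbabilityMeasure η →
      fGammaDiv f Γ Q P ≤ fDivE f η P + ipmW Γ Q η := fun η hη =>
    aux_weak hf hfa h0 hΓM Q P η
  have hatt : fGammaDiv f Γ Q P < ⊤ → ∃ ηs : Measure S, IsProbabilityMeasure ηs ∧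
      fGammaDiv f Γ Q P = fDivE f ηs P + ipmW Γ Q ηs := fun hD => by
    obtain ⟨η, hη, hle⟩ := aux_attain hf hfa h0 hΓc hΓM Q P hD
    exact ⟨η, hη, le_antisymm (hweak η hη) hle⟩
  refine ⟨?_, ?_, le_min ?_ ?_, fun hD => ?_⟩
  · refine le_antisymm (le_iInf₂ fun η hη => hweak η hη) ?_
    rcases eq_or_ne (fGammaDiv f Γ Q P) ⊤ with h | h
    · rw [h]; exact le_top
    · obtain ⟨η, hη, he⟩ := hatt (lt_top_iff_ne_top.2 h)
      rw [he]
      exact iInf₂_le (f := fun (η : Measure S) (_ : η ∈ {η : Measure S | IsProbabilityMeasure η}) =>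
        fDivE f η P + ipmW Γ Q η) η hη
  · rcases eq_or_ne (fGammaDiv f Γ Q P) ⊤ with h | h
    · rw [h]; exact le_top
    · obtain ⟨η, hη, he⟩ := hatt (lt_top_iff_ne_top.2 h)
      rw [he]
      exact add_nonneg (aux_fDiv_nonneg hf η P) (aux_ipm_nonneg h0 Q η)
  · have hW : ipmW Γ Q Q ≤ 0 := by
      refine iSup₂_le fun g _ => ?_
      rw [← EReal.coe_sub, sub_self, EReal.coe_zero]
    calc fGammaDiv f Γ Q P ≤ fDivE f Q P + ipmW Γ Q Q := hweak Q inferInstance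
      _ ≤ fDivE f Q P + 0 := by gcongr
      _ = fDivE f Q P := add_zero _
  · have hP : fDivE f P P = 0 := by
      rw [fDivE, if_pos Measure.AbsolutelyContinuous.rfl,
        aux_eInt_congr P (k := fun _ => ((0 : ℝ) : EReal)) (by
          filter_upwards [Measure.rnDeriv_self P] with x hx
          simp [hx, hf.at_one]),
        aux_eInt_real P (fun _ => 0) measurable_const (integrable_const 0)]
      simp
    have := hweak P inferInstance
    rwa [hP, zero_add] at this
  · obtain ⟨η, hη, he⟩ := hatt hD
    exact ⟨η, hη, he, fun hs η' hη' he' => aux_unique hf hfa h0 hΓM Q P hD hs η η' he he'⟩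
end
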